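/- For c > 0 with c ≠ 1 and every δ ∈ (0,1), locally uniformly for x ∈ (-δ, δ), lim_{n→∞} Kₙ(πx/n, πx/n)/Kₙ(0,0) = G'(1+λ; 2πix)·G(λ; 2πix) − G(1+λ; 2πix)·G'(λ; 2πix), where G' denotes the derivative of G(a;ζ) with respect to ζ. In particular, Lubinsky's wiggle condition fails in a neighborhood of the jump of the weight. -/

import Mathlib

open Filter Set MeasureTheory

/-- `G(a;ζ) = e^{-ζ/2} ∑_{k≥0} ((a)_k/(k!)²) ζ^k`, where `(a)_k` is the Pochhammer symbol. -/
noncomputable def Gfun (a ζ : ℂ) : ℂ :=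
  Complex.exp (-ζ / 2) *
    ∑' k : ℕ, ((ascPochhammer ℂ k).eval a / ((Nat.factorial k : ℂ)) ^ 2) * ζ ^ k

/-- `λ = i·log(c)/π`. -/
noncomputable def lamC (c : ℝ) : ℂ := Complex.I * ((Real.log c / Real.pi : ℝ) : ℂ)

open scoped ComplexConjugate

theorem sum_choose_mul_ascPochhammer_div (n : ℕ) : ∀ b d : ℂ, (∀ k : ℕ, d + k ≠ 0) →
    ∑ m ∈ Finset.range (n + 1), (-1 : ℂ) ^ m * (n.choose m : ℂ) *
        ((ascPochhammer ℂ m).eval b / (ascPochhammer ℂ m).eval d) =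
      (ascPochhammer ℂ n).eval (d - b) / (ascPochhammer ℂ n).eval d := by
  induction n with
  | zero => intro b d _; simp
  | succ n ih =>
    intro b d hd
    have hd' : ∀ k : ℕ, d + 1 + k ≠ 0 := fun k => by
      have := hd (k + 1); push_cast at this; rwa [add_assoc, add_comm (1 : ℂ)]
    have hne : ∀ k, (ascPochhammer ℂ k).eval d ≠ 0 := by
      intro k
      induction k with
      | zero => simp
      | succ k ihk => rw [ascPochhammer_succ_eval]; exact mul_ne_zero ihk (hd k)
    have hleft : ∀ (x : ℂ) (k : ℕ), (ascPochhammer ℂ (k + 1)).eval x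
        = x * (ascPochhammer ℂ k).eval (x + 1) := by
      intro x k
      rw [ascPochhammer_succ_left]; simp
    have hd0 : d ≠ 0 := by simpa using hd 0
    have h1 : ∑ m ∈ Finset.range (n + 1 + 1), (-1 : ℂ) ^ m * ((n + 1).choose m : ℂ) *
          ((ascPochhammer ℂ m).eval b / (ascPochhammer ℂ m).eval d) =
        ∑ m ∈ Finset.range (n + 1), (-1 : ℂ) ^ m * (n.choose m : ℂ) *
          ((ascPochhammer ℂ m).eval b / (ascPochhammer ℂ m).eval d) -
        b / d * ∑ m ∈ Finset.range (n + 1), (-1 : ℂ) ^ m * (n.choose m : ℂ) *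
          ((ascPochhammer ℂ m).eval (b + 1) / (ascPochhammer ℂ m).eval (d + 1)) := by
      rw [Finset.sum_range_succ', Finset.mul_sum]
      have h2 : ∑ m ∈ Finset.range (n + 1), (-1 : ℂ) ^ m * (n.choose m : ℂ) *
          ((ascPochhammer ℂ m).eval b / (ascPochhammer ℂ m).eval d) =
          ∑ m ∈ Finset.range (n + 1), (-1 : ℂ) ^ (m + 1) * (n.choose (m + 1) : ℂ) *
          ((ascPochhammer ℂ (m + 1)).eval b / (ascPochhammer ℂ (m + 1)).eval d) + 1 := by
        have h3 := Finset.sum_range_succ' (fun m => (-1 : ℂ) ^ m * (n.choose m : ℂ) *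
          ((ascPochhammer ℂ m).eval b / (ascPochhammer ℂ m).eval d)) (n + 1)
        rw [Finset.sum_range_succ] at h3
        simpa using h3
      rw [h2, add_sub_right_comm, ← Finset.sum_sub_distrib]
      congr 1
      · refine Finset.sum_congr rfl fun m _ => ?_
        have e1 : (ascPochhammer ℂ (m + 1)).eval b / (ascPochhammer ℂ (m + 1)).eval d =
            b / d * ((ascPochhammer ℂ m).eval (b + 1) / (ascPochhammer ℂ m).eval (d + 1)) := by
          rw [hleft, hleft, mul_div_mul_comm]
        rw [e1, Nat.choose_succ_succ]
        push_cast
        ring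
      · simp
    rw [h1, ih b d hd, ih (b + 1) (d + 1) hd', add_sub_add_right_eq_sub]
    have e2 : (ascPochhammer ℂ n).eval (d + 1) * d
        = (ascPochhammer ℂ n).eval d * (d + n) := by
      rw [← ascPochhammer_succ_eval, hleft, mul_comm]
    have hn1 : (ascPochhammer ℂ n).eval (d + 1) ≠ 0 := by
      intro h0
      rw [h0, zero_mul] at e2
      exact mul_ne_zero (hne n) (hd n) e2.symm
    rw [ascPochhammer_succ_eval, ascPochhammer_succ_eval]
    have hdn := hd n
    have hnn := hne n
    have e3 : (ascPochhammer ℂ n).eval (d + 1) = (ascPochhammer ℂ n).eval d * (d + n) / d := by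
      rw [← e2]; field_simp
    rw [e3]
    field_simp
    ring

/-- The sesquilinear form `∫ P conj(Q) e^{gθ} dθ` over the unit circle, `0 ≤ θ ≤ 2π`. -/
noncomputable def circleForm (g : ℝ) (P Q : Polynomial ℂ) : ℂ :=
  ∫ θ in (0 : ℝ)..2 * Real.pi, P.eval (Complex.exp (θ * Complex.I)) *
    conj (Q.eval (Complex.exp (θ * Complex.I))) * (Real.exp (g * θ) : ℂ)

theorem circleForm_intervalIntegrable (g : ℝ) (P Q : Polynomial ℂ) (a b : ℝ) :
    IntervalIntegrable (fun θ : ℝ => P.eval (Complex.exp (θ * Complex.I)) *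
      conj (Q.eval (Complex.exp (θ * Complex.I))) * (Real.exp (g * θ) : ℂ)) volume a b := by
  apply Continuous.intervalIntegrable
  have h1 : Continuous fun θ : ℝ => Complex.exp (θ * Complex.I) := by fun_prop
  have h2 := P.continuous.comp h1
  have h3 := Complex.continuous_conj.comp (Q.continuous.comp h1)
  exact (h2.mul h3).mul (by fun_prop)

theorem circleForm_add_left (g : ℝ) (P P' Q : Polynomial ℂ) :
    circleForm g (P + P') Q = circleForm g P Q + circleForm g P' Q := by
  unfold circleForm
  rw [← intervalIntegral.integral_add (circleForm_intervalIntegrable ..)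
    (circleForm_intervalIntegrable ..)]
  simp only [Polynomial.eval_add, add_mul]

theorem circleForm_C_mul_left (g : ℝ) (c : ℂ) (P Q : Polynomial ℂ) :
    circleForm g (Polynomial.C c * P) Q = c * circleForm g P Q := by
  unfold circleForm
  rw [← intervalIntegral.integral_const_mul]
  simp only [Polynomial.eval_mul, Polynomial.eval_C, mul_assoc]

theorem circleForm_conj (g : ℝ) (P Q : Polynomial ℂ) :
    conj (circleForm g P Q) = circleForm g Q P := by
  unfold circleForm
  rw [intervalIntegral.integral_of_le (by positivity),
    intervalIntegral.integral_of_le (by positivity), ← integral_conj]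
  congr 1
  ext θ
  simp only [map_mul, Complex.conj_conj, Complex.conj_ofReal]
  ring

theorem circleForm_sum_left {ι : Type*} (g : ℝ) (s : Finset ι) (P : ι → Polynomial ℂ)
    (Q : Polynomial ℂ) : circleForm g (∑ i ∈ s, P i) Q = ∑ i ∈ s, circleForm g (P i) Q := by
  classical
  induction s using Finset.induction_on with
  | empty => simp [circleForm]
  | insert i s hi ih => rw [Finset.sum_insert hi, Finset.sum_insert hi, circleForm_add_left, ih]

theorem circleForm_sum_right {ι : Type*} (g : ℝ) (s : Finset ι) (P : ι → Polynomial ℂ)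
    (Q : Polynomial ℂ) : circleForm g Q (∑ i ∈ s, P i) = ∑ i ∈ s, circleForm g Q (P i) := by
  rw [← circleForm_conj, circleForm_sum_left, map_sum]
  simp only [circleForm_conj]

theorem circleForm_C_mul_right (g : ℝ) (c : ℂ) (P Q : Polynomial ℂ) :
    circleForm g P (Polynomial.C c * Q) = conj c * circleForm g P Q := by
  rw [← circleForm_conj, circleForm_C_mul_left, map_mul, circleForm_conj]

theorem natCast_sub_I_mul_ne_zero {g : ℝ} (hg : g ≠ 0) (x : ℝ) :
    (x : ℂ) - Complex.I * g ≠ 0 := by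
  intro h
  have := congrArg Complex.im h
  simp at this
  exact hg this

theorem circleForm_X_pow {g : ℝ} (hg : g ≠ 0) (k j : ℕ) :
    circleForm g (Polynomial.X ^ k) (Polynomial.X ^ j) =
      (Real.exp (2 * Real.pi * g) - 1) / Complex.I * (1 / (-j - Complex.I * g + k)) := by
  have hne : ((k : ℂ) - j) * Complex.I + g ≠ 0 := by
    intro h
    have := congrArg Complex.re h
    simp at this
    exact hg this
  have h1 : ∀ θ : ℝ, (Polynomial.X ^ k : Polynomial ℂ).eval (Complex.exp (θ * Complex.I)) *
    conj ((Polynomial.X ^ j : Polynomial ℂ).eval (Complex.exp (θ * Complex.I))) *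
      (Real.exp (g * θ) : ℂ) = Complex.exp ((((k : ℂ) - j) * Complex.I + g) * θ) := by
    intro θ
    simp only [Polynomial.eval_pow, Polynomial.eval_X, ← Complex.exp_conj,
      Complex.ofReal_exp, ← Complex.exp_nat_mul, ← Complex.exp_add]
    congr 1
    simp
    ring
  unfold circleForm
  simp only [h1]
  rw [integral_exp_mul_complex hne]
  have h2 : Complex.exp ((((k : ℂ) - j) * Complex.I + g) * ((2 * Real.pi : ℝ) : ℂ)) =
      (Real.exp (2 * Real.pi * g) : ℂ) := by
    have : (((k : ℂ) - j) * Complex.I + g) * ((2 * Real.pi : ℝ) : ℂ) =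
      ((2 * Real.pi * g : ℝ) : ℂ) + ((k : ℤ) - (j : ℤ) : ℤ) * (2 * Real.pi * Complex.I) := by
      push_cast; ring
    rw [this, Complex.exp_add, Complex.exp_int_mul_two_pi_mul_I, mul_one, Complex.ofReal_exp]
  rw [h2]
  simp only [Complex.ofReal_zero, mul_zero, Complex.exp_zero]
  rw [div_mul_div_comm, mul_one]
  congr 1
  ring_nf
  simp only [Complex.I_sq]
  ring

/-- `∑ (a)_m/m! C(n,m) (z-1)^m`, orthogonal on the circle for the weight `e^{gθ}`
when `a = 1 - ig`. -/
noncomputable def jumpPoly (a : ℂ) (n : ℕ) : Polynomial ℂ :=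
  ∑ m ∈ Finset.range (n + 1),
    Polynomial.C ((ascPochhammer ℂ m).eval a / (m.factorial : ℂ) * (n.choose m : ℂ)) *
      (Polynomial.X - 1) ^ m

theorem circleForm_X_sub_one_pow {g : ℝ} (hg : g ≠ 0) (m j : ℕ) :
    circleForm g ((Polynomial.X - 1) ^ m) (Polynomial.X ^ j) =
      (Real.exp (2 * Real.pi * g) - 1) / Complex.I * ((-1) ^ m * (m.factorial : ℂ) /
        ((-j - Complex.I * g) * (ascPochhammer ℂ m).eval (-j - Complex.I * g + 1))) := by
  set s : ℂ := -j - Complex.I * g with hs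
  have hsk : ∀ x : ℝ, s + x ≠ 0 := by
    intro x
    have := natCast_sub_I_mul_ne_zero hg (x - j)
    rw [hs]
    convert this using 1
    push_cast; ring
  have hs0 : s ≠ 0 := by simpa using hsk 0
  have hd : ∀ k : ℕ, s + 1 + k ≠ 0 := fun k => by
    have := hsk (1 + k); push_cast at this; rwa [← add_assoc] at this
  have hasc : ∀ (d : ℂ), (∀ k : ℕ, d + k ≠ 0) → ∀ k, (ascPochhammer ℂ k).eval d ≠ 0 := by
    intro d hd k
    induction k with
    | zero => simp
    | succ k ihk => rw [ascPochhammer_succ_eval]; exact mul_ne_zero ihk (hd k)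
  have hratio : ∀ k : ℕ, (ascPochhammer ℂ k).eval s / (ascPochhammer ℂ k).eval (s + 1)
      = s * (1 / (s + k)) := by
    intro k
    have h1 : (ascPochhammer ℂ (k + 1)).eval s = s * (ascPochhammer ℂ k).eval (s + 1) := by
      rw [ascPochhammer_succ_left]; simp
    rw [ascPochhammer_succ_eval] at h1
    have h2 := hasc _ hd k
    have h3 : s + k ≠ 0 := by simpa using hsk k
    field_simp
    linear_combination h1
  have hv := sum_choose_mul_ascPochhammer_div m s (s + 1) hd
  rw [add_sub_cancel_left, ascPochhammer_eval_one] at hv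
  simp only [hratio] at hv
  rw [sub_eq_add_neg, add_pow, circleForm_sum_left]
  have h1 : ∀ k ∈ Finset.range (m + 1), circleForm g
      ((Polynomial.X : Polynomial ℂ) ^ k * (-1) ^ (m - k) * (m.choose k : Polynomial ℂ))
        (Polynomial.X ^ j) = (Real.exp (2 * Real.pi * g) - 1) / Complex.I * ((-1) ^ m / s) *
        ((-1) ^ k * (m.choose k : ℂ) * (s * (1 / (s + k)))) := by
    intro k hk
    have hk' : k ≤ m := Nat.lt_succ_iff.mp (Finset.mem_range.mp hk)
    have e1 : (Polynomial.X : Polynomial ℂ) ^ k * (-1) ^ (m - k) * (m.choose k : Polynomial ℂ)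
      = Polynomial.C ((-1) ^ (m - k) * (m.choose k : ℂ)) * Polynomial.X ^ k := by
      simp only [map_mul, map_pow, map_neg, map_one, map_natCast]
      ring
    rw [e1, circleForm_C_mul_left, circleForm_X_pow hg, ← hs]
    have e2 : (-1 : ℂ) ^ (m - k) = (-1) ^ m * (-1) ^ k := by
      obtain ⟨r, rfl⟩ := Nat.exists_eq_add_of_le hk'
      rw [Nat.add_sub_cancel_left, pow_add, mul_right_comm, ← mul_pow]
      simp
    rw [e2]
    field_simp
  rw [Finset.sum_congr rfl h1, ← Finset.mul_sum, hv]
  have := hasc _ hd m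
  field_simp

theorem circleForm_jumpPoly_X_pow {g : ℝ} (hg : g ≠ 0) (n j : ℕ) :
    circleForm g (jumpPoly (1 - Complex.I * g) n) (Polynomial.X ^ j) =
      (Real.exp (2 * Real.pi * g) - 1) / Complex.I / (-j - Complex.I * g) *
        ((ascPochhammer ℂ n).eval (-j : ℂ) /
          (ascPochhammer ℂ n).eval (-j - Complex.I * g + 1)) := by
  have hd : ∀ k : ℕ, (-j - Complex.I * g + 1 : ℂ) + k ≠ 0 := by
    intro k
    have := natCast_sub_I_mul_ne_zero hg (1 + k - j)
    convert this using 1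
    push_cast; ring
  have hv := sum_choose_mul_ascPochhammer_div n (1 - Complex.I * g) _ hd
  have e : (-j - Complex.I * g + 1 : ℂ) - (1 - Complex.I * g) = -j := by ring
  rw [e] at hv
  rw [← hv, jumpPoly, circleForm_sum_left, Finset.mul_sum]
  refine Finset.sum_congr rfl fun m _ => ?_
  rw [circleForm_C_mul_left, circleForm_X_sub_one_pow hg]
  have : (m.factorial : ℂ) ≠ 0 := by exact_mod_cast m.factorial_ne_zero
  field_simp

theorem exists_eq_sum_C_mul_of_natDegree_eq {K : Type*} [Field K] {q : ℕ → Polynomial K}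
    (hq : ∀ n, (q n).natDegree = n) (hq0 : ∀ n, q n ≠ 0) (N : ℕ) :
    ∀ P : Polynomial K, P.degree < N →
      ∃ a : ℕ → K, P = ∑ k ∈ Finset.range N, Polynomial.C (a k) * q k := by
  induction N with
  | zero =>
    intro P hP
    refine ⟨fun _ => 0, ?_⟩
    have : P = 0 := by
      by_contra h0
      rw [Polynomial.degree_eq_natDegree h0] at hP
      exact absurd (Nat.cast_lt.mp hP) (Nat.not_lt_zero _)
    simp [this]
  | succ N ih =>
    intro P hP
    have hlc : (q N).leadingCoeff ≠ 0 := Polynomial.leadingCoeff_ne_zero.mpr (hq0 N)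
    have hlc' : (q N).coeff N ≠ 0 := by
      rwa [Polynomial.leadingCoeff, hq N] at hlc
    have hd : (P - Polynomial.C (P.coeff N / (q N).coeff N) * q N).degree < N := by
      rw [Polynomial.degree_lt_iff_coeff_zero]
      intro m hm
      rcases hm.eq_or_lt with rfl | hm
      · simp [hlc']
      · have h1 : P.coeff m = 0 :=
          (Polynomial.degree_lt_iff_coeff_zero P (N + 1)).mp hP m hm
        have h2 : (q N).coeff m = 0 := Polynomial.coeff_eq_zero_of_natDegree_lt (by rw [hq]; exact hm)
        simp [h1, h2]
    obtain ⟨a, ha⟩ := ih _ hd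
    refine ⟨fun k => if k = N then P.coeff N / (q N).coeff N else a k, ?_⟩
    rw [Finset.sum_range_succ]
    simp only [if_true]
    rw [sub_eq_iff_eq_add] at ha
    conv_lhs => rw [ha]
    congr 1
    refine Finset.sum_congr rfl fun k hk => ?_
    rw [if_neg (Finset.mem_range.mp hk).ne]

theorem natDegree_X_sub_one_pow_le (m : ℕ) :
    ((Polynomial.X - 1 : Polynomial ℂ) ^ m).natDegree ≤ m := by
  refine Polynomial.natDegree_pow_le.trans ?_
  have : (Polynomial.X - 1 : Polynomial ℂ).natDegree ≤ 1 := Polynomial.natDegree_X_sub_C_le 1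
  nlinarith

theorem natDegree_jumpPoly_le (a : ℂ) (n : ℕ) : (jumpPoly a n).natDegree ≤ n := by
  refine Polynomial.natDegree_sum_le_of_forall_le _ _ fun m hm => ?_
  refine (Polynomial.natDegree_C_mul_le _ _).trans ((natDegree_X_sub_one_pow_le m).trans ?_)
  exact Nat.lt_succ_iff.mp (Finset.mem_range.mp hm)

theorem coeff_jumpPoly (a : ℂ) (n : ℕ) :
    (jumpPoly a n).coeff n = (ascPochhammer ℂ n).eval a / (n.factorial : ℂ) := by
  rw [jumpPoly, Finset.sum_range_succ, Polynomial.coeff_add, Polynomial.finsetSum_coeff,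
    Finset.sum_eq_zero, zero_add, Polynomial.coeff_C_mul]
  · have h1 : (Polynomial.X - 1 : Polynomial ℂ).Monic := Polynomial.monic_X_sub_C 1
    have h2 : ((Polynomial.X - 1 : Polynomial ℂ) ^ n).natDegree = n := by
      rw [h1.natDegree_pow, show (Polynomial.X - 1 : Polynomial ℂ).natDegree = 1 from
        Polynomial.natDegree_X_sub_C 1, mul_one]
    have h3 := (h1.pow n).coeff_natDegree
    rw [h2] at h3
    simp [h3]
  · intro m hm
    apply Polynomial.coeff_eq_zero_of_natDegree_lt
    exact lt_of_le_of_lt ((Polynomial.natDegree_C_mul_le _ _).trans (natDegree_X_sub_one_pow_le m))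
      (Finset.mem_range.mp hm)

theorem ascPochhammer_eval_ne_zero_of_re_pos {a : ℂ} (ha : 0 < a.re) (n : ℕ) :
    (ascPochhammer ℂ n).eval a ≠ 0 := by
  induction n with
  | zero => simp
  | succ k ihk =>
    rw [ascPochhammer_succ_eval]
    refine mul_ne_zero ihk fun h => ?_
    have := congrArg Complex.re h
    simp at this
    have : (0 : ℝ) ≤ k := Nat.cast_nonneg k
    linarith

theorem coeff_jumpPoly_ne_zero {a : ℂ} (ha : 0 < a.re) (n : ℕ) : (jumpPoly a n).coeff n ≠ 0 := by
  rw [coeff_jumpPoly]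
  exact div_ne_zero (ascPochhammer_eval_ne_zero_of_re_pos ha n)
    (by exact_mod_cast n.factorial_ne_zero)

theorem natDegree_jumpPoly {a : ℂ} (ha : 0 < a.re) (n : ℕ) : (jumpPoly a n).natDegree = n :=
  le_antisymm (natDegree_jumpPoly_le a n)
    (Polynomial.le_natDegree_of_ne_zero (coeff_jumpPoly_ne_zero ha n))

theorem ascPochhammer_eval_conj (a : ℂ) (n : ℕ) :
    conj ((ascPochhammer ℂ n).eval a) = (ascPochhammer ℂ n).eval (conj a) := by
  induction n with
  | zero => simp
  | succ k ih => rw [ascPochhammer_succ_eval, ascPochhammer_succ_eval, map_mul, ih]; simp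

/-- The squared norm of every `jumpPoly (1 - ig) n` in the weight `e^{gθ}`. -/
noncomputable def jumpNorm (g : ℝ) : ℝ := (Real.exp (2 * Real.pi * g) - 1) / g

theorem jumpNorm_pos {g : ℝ} (hg : g ≠ 0) : 0 < jumpNorm g := by
  unfold jumpNorm
  have hpi := Real.pi_pos
  rcases lt_or_gt_of_ne hg with h | h
  · apply div_pos_of_neg_of_neg _ h
    have : Real.exp (2 * Real.pi * g) < 1 := Real.exp_lt_one_iff.mpr (by nlinarith)
    linarith
  · apply div_pos _ h
    have : 1 < Real.exp (2 * Real.pi * g) := Real.one_lt_exp_iff.mpr (by positivity)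
    linarith

theorem circleForm_jumpPoly_of_natDegree_le {g : ℝ} (hg : g ≠ 0) (n : ℕ) (Q : Polynomial ℂ)
    (hQ : Q.natDegree ≤ n) : circleForm g (jumpPoly (1 - Complex.I * g) n) Q =
      conj (Q.coeff n) * circleForm g (jumpPoly (1 - Complex.I * g) n) (Polynomial.X ^ n) := by
  conv_lhs => rw [Polynomial.as_sum_range_C_mul_X_pow' Q (Nat.lt_succ_of_le hQ)]
  rw [circleForm_sum_right, Finset.sum_range_succ, Finset.sum_eq_zero, zero_add,
    circleForm_C_mul_right]
  intro j hj
  rw [circleForm_C_mul_right, circleForm_jumpPoly_X_pow hg,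
    ascPochhammer_eval_neg_coe_nat_of_lt (Finset.mem_range.mp hj)]
  simp

theorem circleForm_jumpPoly_self {g : ℝ} (hg : g ≠ 0) (n : ℕ) :
    circleForm g (jumpPoly (1 - Complex.I * g) n) (jumpPoly (1 - Complex.I * g) n) =
      jumpNorm g := by
  rw [circleForm_jumpPoly_of_natDegree_le hg n _ (natDegree_jumpPoly_le _ _), coeff_jumpPoly,
    circleForm_jumpPoly_X_pow hg, map_div₀, ascPochhammer_eval_conj]
  have e1 : conj (1 - Complex.I * g : ℂ) = Complex.I * g + 1 := by
    simp; ring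
  have hasc : ∀ x : ℂ, (ascPochhammer ℂ n).eval (-n - x + 1) =
      (-1) ^ n * (ascPochhammer ℂ n).eval x := by
    intro x
    have h1 := ascPochhammer_eval_neg_eq_descPochhammer ℂ (-x) n
    have h2 := descPochhammer_eval_eq_ascPochhammer ℂ (-x) n
    rw [neg_neg] at h1
    rw [h1, ← mul_assoc, ← mul_pow, h2]
    simp
    ring_nf
  have e2 : (ascPochhammer ℂ n).eval (-n : ℂ) = (-1) ^ n * (n.factorial : ℂ) := by
    have := hasc 1
    rw [ascPochhammer_eval_one, sub_add_cancel] at this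
    exact this
  rw [e1, hasc, e2]
  have e3 : (ascPochhammer ℂ n).eval (Complex.I * g) * (Complex.I * g + n) =
      Complex.I * g * (ascPochhammer ℂ n).eval (Complex.I * g + 1) := by
    rw [← ascPochhammer_succ_eval, ascPochhammer_succ_left]; simp
  have hgC : (g : ℂ) ≠ 0 := by exact_mod_cast hg
  have h4 : (ascPochhammer ℂ n).eval (Complex.I * g + 1) ≠ 0 :=
    ascPochhammer_eval_ne_zero_of_re_pos (by simp) n
  have h5 : (ascPochhammer ℂ n).eval (Complex.I * g) * (Complex.I * g + n) ≠ 0 := by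
    rw [e3]; exact mul_ne_zero (mul_ne_zero Complex.I_ne_zero hgC) h4
  have h6 := left_ne_zero_of_mul h5
  have h7 := right_ne_zero_of_mul h5
  have h8 : (n.factorial : ℂ) ≠ 0 := by exact_mod_cast n.factorial_ne_zero
  have h9 : (-n - Complex.I * g : ℂ) ≠ 0 := by
    intro h; apply h7; linear_combination -h
  have e4 : (-n - Complex.I * g : ℂ) = -(Complex.I * g + n) := by ring
  rw [jumpNorm, e4, map_natCast]
  push_cast
  set A := (ascPochhammer ℂ n).eval (Complex.I * g + 1)
  set B := (ascPochhammer ℂ n).eval (Complex.I * g)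
  set E := Complex.exp (2 * Real.pi * g) - 1
  have e5 : A / (n.factorial : ℂ) * (E / Complex.I / -(Complex.I * g + n) *
      ((-1) ^ n * (n.factorial : ℂ) / ((-1) ^ n * B))) =
      - (A * E) / (Complex.I * (B * (Complex.I * g + n))) := by
    have : ((-1 : ℂ)) ^ n ≠ 0 := by simp
    field_simp
  rw [e5, e3]
  field_simp
  simp

theorem circleForm_jumpPoly {g : ℝ} (hg : g ≠ 0) (n k : ℕ) :
    circleForm g (jumpPoly (1 - Complex.I * g) n) (jumpPoly (1 - Complex.I * g) k) =
      if n = k then (jumpNorm g : ℂ) else 0 := by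
  have key : ∀ {n k : ℕ}, k < n →
      circleForm g (jumpPoly (1 - Complex.I * g) n) (jumpPoly (1 - Complex.I * g) k) = 0 := by
    intro n k hkn
    have hk := natDegree_jumpPoly_le (1 - Complex.I * g) k
    rw [circleForm_jumpPoly_of_natDegree_le hg n _ (hk.trans hkn.le),
      Polynomial.coeff_eq_zero_of_natDegree_lt (hk.trans_lt hkn)]
    simp
  split_ifs with h
  · rw [← h, circleForm_jumpPoly_self hg]
  · rcases lt_or_gt_of_ne h with h | h
    · rw [← circleForm_conj, key h, map_zero]
    · exact key h

/-- The integral of `|Q|²` on the circle against the weight `e^{gθ}`. -/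
noncomputable def circleEnergy (g : ℝ) (Q : Polynomial ℂ) : ℝ :=
  ∫ θ in (0 : ℝ)..2 * Real.pi, ‖Q.eval (Complex.exp (θ * Complex.I))‖ ^ 2 * Real.exp (g * θ)

theorem circleForm_self (g : ℝ) (Q : Polynomial ℂ) : circleForm g Q Q = circleEnergy g Q := by
  unfold circleForm circleEnergy
  rw [← intervalIntegral.integral_ofReal]
  congr 1
  ext θ
  rw [Complex.mul_conj, Complex.normSq_eq_norm_sq]
  push_cast
  rfl

/-- The Christoffel–Darboux kernel on the diagonal for the weight `e^{gθ}` on the circle. -/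
noncomputable def circleKernel (g : ℝ) (N : ℕ) (φ : ℝ) : ℝ :=
  (∑ k ∈ Finset.range N,
    ‖(jumpPoly (1 - Complex.I * g) k).eval (Complex.exp (φ * Complex.I))‖ ^ 2) / jumpNorm g

theorem circleEnergy_sum {g : ℝ} (hg : g ≠ 0) (N : ℕ) (a : ℕ → ℂ) :
    circleEnergy g (∑ k ∈ Finset.range N, Polynomial.C (a k) * jumpPoly (1 - Complex.I * g) k) =
      jumpNorm g * ∑ k ∈ Finset.range N, ‖a k‖ ^ 2 := by
  have h : ((circleEnergy g (∑ k ∈ Finset.range N, Polynomial.C (a k) *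
      jumpPoly (1 - Complex.I * g) k) : ℝ) : ℂ) =
      ((jumpNorm g * ∑ k ∈ Finset.range N, ‖a k‖ ^ 2 : ℝ) : ℂ) := by
    rw [← circleForm_self, circleForm_sum_left]
    push_cast
    rw [Finset.mul_sum]
    refine Finset.sum_congr rfl fun k hk => ?_
    rw [circleForm_C_mul_left, circleForm_sum_right, Finset.sum_eq_single k]
    · rw [circleForm_C_mul_right, circleForm_jumpPoly hg, if_pos rfl, ← mul_assoc, Complex.mul_conj,
        Complex.normSq_eq_norm_sq]
      push_cast; ring
    · intro j _ hjk
      rw [circleForm_C_mul_right, circleForm_jumpPoly hg, if_neg hjk.symm, mul_zero]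
    · intro h; exact absurd hk h
  exact_mod_cast h

theorem norm_eval_sq_le_circleKernel_mul {g : ℝ} (hg : g ≠ 0) (N : ℕ) (Q : Polynomial ℂ)
    (hQ : Q.degree < N) (φ : ℝ) :
    ‖Q.eval (Complex.exp (φ * Complex.I))‖ ^ 2 ≤ circleKernel g N φ * circleEnergy g Q := by
  have hre : 0 < (1 - Complex.I * g : ℂ).re := by simp
  obtain ⟨a, ha⟩ := exists_eq_sum_C_mul_of_natDegree_eq (natDegree_jumpPoly hre)
    (fun n h0 => coeff_jumpPoly_ne_zero hre n (by rw [h0, Polynomial.coeff_zero])) N Q hQ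
  have hN := jumpNorm_pos hg
  rw [ha, circleEnergy_sum hg, circleKernel, ← mul_assoc, div_mul_cancel₀ _ hN.ne',
    Polynomial.eval_finsetSum]
  simp only [Polynomial.eval_mul, Polynomial.eval_C]
  have h1 : ‖∑ k ∈ Finset.range N, a k *
      (jumpPoly (1 - Complex.I * g) k).eval (Complex.exp (φ * Complex.I))‖ ≤
      ∑ k ∈ Finset.range N, ‖(jumpPoly (1 - Complex.I * g) k).eval (Complex.exp (φ * Complex.I))‖ *
        ‖a k‖ := by
    refine (norm_sum_le _ _).trans_eq (Finset.sum_congr rfl fun k _ => ?_)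
    rw [norm_mul, mul_comm]
  calc _ ≤ _ := pow_le_pow_left₀ (norm_nonneg _) h1 2
    _ ≤ _ := Finset.sum_mul_sq_le_sq_mul_sq _ _ _

theorem exists_norm_eval_sq_eq_circleKernel_mul {g : ℝ} (hg : g ≠ 0) {N : ℕ} (hN : N ≠ 0) (φ : ℝ) :
    ∃ Q : Polynomial ℂ, Q.natDegree < N ∧ 0 < circleEnergy g Q ∧
      ‖Q.eval (Complex.exp (φ * Complex.I))‖ ^ 2 = circleKernel g N φ * circleEnergy g Q := by
  set v : ℕ → ℂ := fun k => (jumpPoly (1 - Complex.I * g) k).eval (Complex.exp (φ * Complex.I))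
    with hv
  have hJ := jumpNorm_pos hg
  have hS : 0 < ∑ k ∈ Finset.range N, ‖v k‖ ^ 2 := by
    refine Finset.sum_pos' (fun _ _ => by positivity) ⟨0, by simpa using Nat.pos_of_ne_zero hN, ?_⟩
    simp [hv, jumpPoly]
  refine ⟨∑ k ∈ Finset.range N, Polynomial.C (conj (v k)) * jumpPoly (1 - Complex.I * g) k,
    ?_, ?_, ?_⟩
  · refine (Polynomial.natDegree_sum_le_of_forall_le (n := N - 1) _ _ fun k hk => ?_).trans_lt
      (Nat.sub_lt (Nat.pos_of_ne_zero hN) one_pos)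
    refine (Polynomial.natDegree_C_mul_le _ _).trans ((natDegree_jumpPoly_le _ _).trans ?_)
    exact Nat.le_sub_one_of_lt (Finset.mem_range.mp hk)
  · rw [circleEnergy_sum hg]
    simp only [RCLike.norm_conj]
    positivity
  · rw [circleEnergy_sum hg, circleKernel, Polynomial.eval_finsetSum]
    simp only [Polynomial.eval_mul, Polynomial.eval_C, RCLike.norm_conj]
    have h1 : ∑ k ∈ Finset.range N, conj (v k) *
        (jumpPoly (1 - Complex.I * g) k).eval (Complex.exp (φ * Complex.I)) =
        ((∑ k ∈ Finset.range N, ‖v k‖ ^ 2 : ℝ) : ℂ) := by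
      push_cast
      refine Finset.sum_congr rfl fun k _ => ?_
      rw [mul_comm]
      change v k * conj (v k) = _
      rw [Complex.mul_conj, Complex.normSq_eq_norm_sq]
      push_cast; rfl
    rw [h1, Complex.norm_real, Real.norm_of_nonneg hS.le, ← mul_assoc, div_mul_cancel₀ _ hJ.ne', sq]

/-- Coefficients of Kummer's function `M(a; 1; ζ)`. -/
noncomputable def kummerCoeff (a : ℂ) (k : ℕ) : ℂ :=
  (ascPochhammer ℂ k).eval a / ((Nat.factorial k : ℂ)) ^ 2

/-- Kummer's function `M(a; 1; ζ)`. -/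
noncomputable def kummer (a ζ : ℂ) : ℂ := ∑' k : ℕ, kummerCoeff a k * ζ ^ k

theorem kummerCoeff_succ (a : ℂ) (k : ℕ) :
    kummerCoeff a (k + 1) * ((k : ℂ) + 1) ^ 2 = kummerCoeff a k * (a + k) := by
  have h1 : (k.factorial : ℂ) ≠ 0 := by exact_mod_cast k.factorial_ne_zero
  have h2 : ((k : ℂ) + 1) ≠ 0 := by exact_mod_cast k.succ_ne_zero
  rw [kummerCoeff, kummerCoeff, ascPochhammer_succ_eval, Nat.factorial_succ]
  push_cast
  field_simp

theorem summable_norm_kummerCoeff (a : ℂ) (R : ℝ) :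
    Summable fun k => ‖kummerCoeff a k‖ * R ^ k := by
  refine summable_of_ratio_norm_eventually_le (r := 1 / 2) (by norm_num) ?_
  have h1 : Tendsto (fun k : ℕ => ((‖a‖ + 1) * |R|) / ((k : ℝ) + 1)) atTop (nhds 0) :=
    tendsto_const_nhds.div_atTop (tendsto_atTop_add_const_right _ _ tendsto_natCast_atTop_atTop)
  filter_upwards [h1.eventually (gt_mem_nhds (show (0 : ℝ) < 1 / 2 by norm_num))] with k hk
  have hk0 : (0 : ℝ) < k + 1 := by positivity
  have h2 := congrArg norm (kummerCoeff_succ a k)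
  rw [norm_mul, norm_mul, norm_pow] at h2
  have h3 : ‖(k : ℂ) + 1‖ = k + 1 := by
    have : ((k : ℂ) + 1) = ((k + 1 : ℕ) : ℂ) := by push_cast; rfl
    rw [this, Complex.norm_natCast]; push_cast; rfl
  rw [h3] at h2
  have h4 : ‖a + k‖ ≤ (‖a‖ + 1) * (k + 1) := by
    refine (norm_add_le _ _).trans ?_
    rw [Complex.norm_natCast]
    nlinarith [norm_nonneg a, Nat.cast_nonneg (α := ℝ) k, mul_nonneg (norm_nonneg a) (Nat.cast_nonneg (α := ℝ) k)]
  have h5 : ‖kummerCoeff a (k + 1)‖ ≤ ‖kummerCoeff a k‖ * (‖a‖ + 1) / (k + 1) := by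
    rw [le_div_iff₀ hk0]
    have : ‖kummerCoeff a (k + 1)‖ * (k + 1) * (k + 1) ≤ ‖kummerCoeff a k‖ * (‖a‖ + 1) * (k + 1) := by
      calc _ = ‖kummerCoeff a (k + 1)‖ * (k + 1) ^ 2 := by ring
        _ = ‖kummerCoeff a k‖ * ‖a + k‖ := h2
        _ ≤ ‖kummerCoeff a k‖ * ((‖a‖ + 1) * (k + 1)) := by gcongr
        _ = _ := by ring
    exact le_of_mul_le_mul_right this hk0
  rw [norm_mul, norm_mul, norm_norm, norm_norm, norm_pow, norm_pow, Real.norm_eq_abs]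
  calc ‖kummerCoeff a (k + 1)‖ * |R| ^ (k + 1)
      ≤ ‖kummerCoeff a k‖ * (‖a‖ + 1) / (k + 1) * |R| ^ (k + 1) := by gcongr
    _ = ((‖a‖ + 1) * |R|) / ((k : ℝ) + 1) * (‖kummerCoeff a k‖ * |R| ^ k) := by ring
    _ ≤ 1 / 2 * (‖kummerCoeff a k‖ * |R| ^ k) := by gcongr

theorem summable_kummer (a ζ : ℂ) : Summable fun k => kummerCoeff a k * ζ ^ k := by
  refine Summable.of_norm ?_
  simpa only [norm_mul, norm_pow] using summable_norm_kummerCoeff a ‖ζ‖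

theorem continuous_kummer (a : ℂ) : Continuous (kummer a) := by
  rw [continuous_iff_continuousAt]
  intro ζ
  refine tendsto_tsum_of_dominated_convergence (summable_norm_kummerCoeff a (‖ζ‖ + 1))
    (fun k => ?_) ?_
  · exact (by fun_prop : Continuous fun z => kummerCoeff a k * z ^ k).continuousAt
  · have : ∀ᶠ z in nhds ζ, ‖z‖ < ‖ζ‖ + 1 :=
      continuous_norm.continuousAt.eventually (gt_mem_nhds (lt_add_one _))
    filter_upwards [this] with z hz k
    rw [norm_mul, norm_pow]
    gcongr

theorem eval_jumpPoly (a : ℂ) (n : ℕ) (z : ℂ) :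
    (jumpPoly a n).eval z =
      ∑' m : ℕ, kummerCoeff a m * ((n.descFactorial m : ℂ) * (z - 1) ^ m) := by
  rw [tsum_eq_sum (s := Finset.range (n + 1)), jumpPoly, Polynomial.eval_finsetSum]
  · refine Finset.sum_congr rfl fun m _ => ?_
    have h1 : (m.factorial : ℂ) ≠ 0 := by exact_mod_cast m.factorial_ne_zero
    simp only [Polynomial.eval_mul, Polynomial.eval_C, Polynomial.eval_pow, Polynomial.eval_sub,
      Polynomial.eval_X, Polynomial.eval_one, kummerCoeff, Nat.descFactorial_eq_factorial_mul_choose]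
    push_cast
    field_simp
  · intro m hm
    have : n < m := by simpa using hm
    rw [Nat.descFactorial_eq_zero_iff_lt.mpr this]
    simp

theorem norm_exp_mul_I_sub_one_le (φ : ℝ) : ‖Complex.exp (φ * Complex.I) - 1‖ ≤ |φ| := by
  rw [mul_comm]
  exact Real.norm_exp_I_mul_ofReal_sub_one_le

theorem norm_jumpPoly_term_le {k : ℕ} {φ R : ℝ} (h : k * |φ| ≤ R) (a : ℂ) (m : ℕ) :
    ‖kummerCoeff a m * ((k.descFactorial m : ℂ) * (Complex.exp (φ * Complex.I) - 1) ^ m)‖ ≤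
      ‖kummerCoeff a m‖ * R ^ m := by
  rw [norm_mul, norm_mul, norm_pow, Complex.norm_natCast]
  gcongr
  calc (k.descFactorial m : ℝ) * ‖Complex.exp (φ * Complex.I) - 1‖ ^ m
      ≤ (k : ℝ) ^ m * |φ| ^ m := by
        gcongr
        · exact_mod_cast Nat.descFactorial_le_pow k m
        · exact norm_exp_mul_I_sub_one_le φ
    _ = (k * |φ|) ^ m := (mul_pow _ _ _).symm
    _ ≤ R ^ m := by gcongr

theorem norm_eval_jumpPoly_le {k : ℕ} {φ R : ℝ} (h : k * |φ| ≤ R) (a : ℂ) :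
    ‖(jumpPoly a k).eval (Complex.exp (φ * Complex.I))‖ ≤ ∑' m, ‖kummerCoeff a m‖ * R ^ m := by
  rw [eval_jumpPoly]
  exact tsum_of_norm_bounded (summable_norm_kummerCoeff a R).hasSum (norm_jumpPoly_term_le h a)

theorem tendsto_descFactorial_mul_pow {ι : Type*} {l : Filter ι} {k : ι → ℕ} {z : ι → ℂ} {w : ℂ}
    (h0 : Tendsto z l (nhds 0)) (h1 : Tendsto (fun i => (k i : ℂ) * z i) l (nhds w)) (m : ℕ) :
    Tendsto (fun i => ((k i).descFactorial m : ℂ) * z i ^ m) l (nhds (w ^ m)) := by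
  induction m with
  | zero => simpa using tendsto_const_nhds
  | succ m ih =>
    have h2 : Tendsto (fun i => ((k i : ℂ) * z i - m * z i) *
        (((k i).descFactorial m : ℂ) * z i ^ m)) l (nhds ((w - m * 0) * w ^ m)) :=
      (h1.sub (h0.const_mul _)).mul ih
    rw [mul_zero, sub_zero, ← pow_succ'] at h2
    refine h2.congr fun i => ?_
    rw [Nat.descFactorial_succ]
    rcases le_or_gt m (k i) with hm | hm
    · push_cast [Nat.cast_sub hm]; ring
    · rw [Nat.descFactorial_eq_zero_iff_lt.mpr hm]; simp

theorem tendsto_eval_jumpPoly {ι : Type*} {l : Filter ι} {k : ι → ℕ} {φ : ι → ℝ} {τ : ℝ}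
    (h0 : Tendsto φ l (nhds 0)) (h1 : Tendsto (fun i => k i * φ i) l (nhds τ)) (a : ℂ) :
    Tendsto (fun i => (jumpPoly a (k i)).eval (Complex.exp (φ i * Complex.I))) l
      (nhds (kummer a (τ * Complex.I))) := by
  simp only [eval_jumpPoly]
  have habs := h1.abs
  refine tendsto_tsum_of_dominated_convergence (summable_norm_kummerCoeff a (|τ| + 1))
    (fun m => ?_) ?_
  · refine Tendsto.const_mul _ (tendsto_descFactorial_mul_pow ?_ ?_ m)
    · refine squeeze_zero_norm (fun i => norm_exp_mul_I_sub_one_le _) ?_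
      simpa using h0.abs
    · have h2 : Tendsto (fun i => ((k i * φ i : ℝ) : ℂ) * Complex.I) l
          (nhds ((τ : ℂ) * Complex.I)) :=
        ((Complex.continuous_ofReal.tendsto τ).comp h1).mul_const _
      have h3 : Tendsto (fun i => (k i : ℂ) * (Complex.exp (φ i * Complex.I) - 1 - φ i * Complex.I))
          l (nhds 0) := by
        refine squeeze_zero_norm' (a := fun i => |k i * φ i| * |φ i|) ?_ ?_
        · have : ∀ᶠ i in l, |φ i| < 1 := by
            have := h0.abs
            rw [abs_zero] at this
            exact this.eventually (gt_mem_nhds one_pos)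
          filter_upwards [this] with i hi
          have e : ‖(φ i : ℂ) * Complex.I‖ = |φ i| := by simp
          rw [norm_mul, Complex.norm_natCast, abs_mul, Nat.abs_cast, mul_assoc, ← sq]
          gcongr
          have := Complex.norm_exp_sub_one_sub_id_le (x := φ i * Complex.I) (by rw [e]; exact hi.le)
          rwa [e] at this
        · simpa using habs.mul h0.abs
      have h4 := h2.add h3
      rw [add_zero] at h4
      refine h4.congr fun i => ?_
      push_cast; ring
  · filter_upwards [habs.eventually (gt_mem_nhds (lt_add_one _))] with i hi m
    refine norm_jumpPoly_term_le ?_ a m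
    rw [abs_mul, Nat.abs_cast] at hi
    exact hi.le

theorem sum_range_div_eq_integral_floor (F : ℕ → ℝ) {N : ℕ} (hN : N ≠ 0) :
    (∑ k ∈ Finset.range N, F k) / N = ∫ t in (0 : ℝ)..1, F ⌊N * t⌋₊ := by
  have hN0 : (0 : ℝ) < N := by exact_mod_cast Nat.pos_of_ne_zero hN
  have key : ∀ k : ℕ, ∀ᵐ t : ℝ ∂(volume.restrict (uIoc ((k : ℝ) / N) (((k + 1 : ℕ) : ℝ) / N))),
      F k = F ⌊(N : ℝ) * t⌋₊ := by
    intro k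
    have hle : (k : ℝ) / N ≤ ((k + 1 : ℕ) : ℝ) / N := by gcongr; simp
    rw [uIoc_of_le hle, ← restrict_Ioo_eq_restrict_Ioc]
    refine (ae_restrict_iff' measurableSet_Ioo).mpr (Eventually.of_forall fun t ht => ?_)
    congr 1
    symm
    rw [Nat.floor_eq_iff (mul_nonneg hN0.le ((by positivity : (0 : ℝ) ≤ k / N).trans ht.1.le))]
    have h1 := ht.1
    have h2 := ht.2
    rw [div_lt_iff₀ hN0] at h1
    rw [lt_div_iff₀ hN0] at h2
    push_cast at h2
    constructor <;> linarith
  have h1 : ∀ k < N, IntervalIntegrable (fun t : ℝ => F ⌊N * t⌋₊) volume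
      ((fun k : ℕ => (k : ℝ) / N) k) ((fun k : ℕ => (k : ℝ) / N) (k + 1)) := fun k _ =>
    (intervalIntegrable_const (c := F k)).congr_ae (key k)
  have h2 := intervalIntegral.sum_integral_adjacent_intervals h1
  simp only [Nat.cast_zero, zero_div, div_self hN0.ne'] at h2
  rw [← h2, Finset.sum_div]
  refine Finset.sum_congr rfl fun k _ => ?_
  rw [← intervalIntegral.integral_congr_ae_restrict (key k), intervalIntegral.integral_const,
    smul_eq_mul]
  push_cast
  field_simp
  ring

theorem tendsto_circleKernel_div {ι : Type*} {l : Filter ι} [l.IsCountablyGenerated] (g : ℝ)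
    {N : ι → ℕ} {φ : ι → ℝ} {τ : ℝ} (hN : Tendsto N l atTop)
    (h1 : Tendsto (fun i => N i * φ i) l (nhds τ)) :
    Tendsto (fun i => circleKernel g (N i) (φ i) / N i) l
      (nhds ((∫ t in (0 : ℝ)..1, ‖kummer (1 - Complex.I * g) (τ * t * Complex.I)‖ ^ 2) /
        jumpNorm g)) := by
  have hNR : Tendsto (fun i => (N i : ℝ)) l atTop := tendsto_natCast_atTop_atTop.comp hN
  have hne : ∀ᶠ i in l, N i ≠ 0 := hN.eventually_ne_atTop 0
  have h0 : Tendsto φ l (nhds 0) := by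
    refine (h1.div_atTop hNR).congr' ?_
    filter_upwards [hne] with i hi
    have : (N i : ℝ) ≠ 0 := by exact_mod_cast hi
    field_simp
  set a : ℂ := 1 - Complex.I * g
  set R : ℝ := |τ| + 1
  set B : ℝ := ∑' m, ‖kummerCoeff a m‖ * R ^ m
  have hlim : Tendsto (fun i => ∫ t in (0 : ℝ)..1,
      ‖(jumpPoly a ⌊N i * t⌋₊).eval (Complex.exp (φ i * Complex.I))‖ ^ 2) l
      (nhds (∫ t in (0 : ℝ)..1, ‖kummer a (τ * t * Complex.I)‖ ^ 2)) := by
    refine intervalIntegral.tendsto_integral_filter_of_dominated_convergence (fun _ => B ^ 2)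
      ?_ ?_ intervalIntegrable_const ?_
    · refine Eventually.of_forall fun i => Measurable.aestronglyMeasurable ?_
      exact (measurable_from_nat (f := fun k : ℕ =>
        ‖(jumpPoly a k).eval (Complex.exp (φ i * Complex.I))‖ ^ 2)).comp
        (Nat.measurable_floor.comp (measurable_const_mul _))
    · filter_upwards [h1.abs.eventually (gt_mem_nhds (lt_add_one _))] with i hi
      refine Eventually.of_forall fun t ht => ?_
      rw [uIoc_of_le zero_le_one] at ht
      rw [Real.norm_of_nonneg (by positivity)]
      refine pow_le_pow_left₀ (norm_nonneg _) (norm_eval_jumpPoly_le ?_ a) 2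
      rw [abs_mul, Nat.abs_cast] at hi
      refine le_trans ?_ hi.le
      gcongr
      refine Nat.floor_le_of_le ?_
      nlinarith [ht.2, Nat.cast_nonneg (α := ℝ) (N i)]
    · refine Eventually.of_forall fun t ht => ?_
      rw [uIoc_of_le zero_le_one] at ht
      have h2 : Tendsto (fun i => (⌊N i * t⌋₊ : ℝ) * φ i) l (nhds (τ * t)) := by
        have h3 : Tendsto (fun i => ((⌊N i * t⌋₊ : ℝ) - N i * t) * φ i) l (nhds 0) := by
          refine squeeze_zero_norm (a := fun i => |φ i|) (fun i => ?_) (by simpa using h0.abs)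
          rw [Real.norm_eq_abs, abs_mul]
          have h4 : |(⌊N i * t⌋₊ : ℝ) - N i * t| ≤ 1 := by
            have h5 := Nat.floor_le (mul_nonneg (Nat.cast_nonneg (α := ℝ) (N i)) ht.1.le)
            have h6 := Nat.lt_floor_add_one ((N i : ℝ) * t)
            rw [abs_le]; constructor <;> linarith
          nlinarith [abs_nonneg (φ i)]
        have h4 := h3.add (h1.mul_const t)
        rw [zero_add] at h4
        refine h4.congr fun i => by ring
      have h3 := tendsto_eval_jumpPoly h0 h2 a
      have := (h3.norm).pow 2
      simpa using this
  refine (hlim.div_const (jumpNorm g)).congr' ?_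
  filter_upwards [hne] with i hi
  rw [← sum_range_div_eq_integral_floor (fun k =>
    ‖(jumpPoly a k).eval (Complex.exp (φ i * Complex.I))‖ ^ 2) hi, circleKernel, div_right_comm]

theorem exp_neg_mul_kummer (a ζ : ℂ) : Complex.exp (-ζ) * kummer a ζ = kummer (1 - a) (-ζ) := by
  have h1 : Summable fun k => ‖kummerCoeff a k * ζ ^ k‖ := by
    simpa only [norm_mul, norm_pow] using summable_norm_kummerCoeff a ‖ζ‖
  have h2 : Summable fun k : ℕ => ‖(-ζ) ^ k / (k.factorial : ℂ)‖ :=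
    NormedSpace.norm_expSeries_div_summable (-ζ)
  have h3 : Complex.exp (-ζ) = ∑' k : ℕ, (-ζ) ^ k / (k.factorial : ℂ) := by
    rw [Complex.exp_eq_exp_ℂ, NormedSpace.exp_eq_tsum_div]
  rw [mul_comm, h3, kummer, tsum_mul_tsum_eq_tsum_sum_range_of_summable_norm h1 h2, kummer]
  congr 1
  ext n
  have hd : ∀ k : ℕ, (1 : ℂ) + k ≠ 0 := fun k => by
    rw [add_comm]; exact_mod_cast k.succ_ne_zero
  have hv := sum_choose_mul_ascPochhammer_div n a 1 hd
  simp only [ascPochhammer_eval_one] at hv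
  have hn : (n.factorial : ℂ) ≠ 0 := by exact_mod_cast n.factorial_ne_zero
  have h4 : kummerCoeff (1 - a) n * (-ζ) ^ n = (-ζ) ^ n / (n.factorial : ℂ) *
      ((ascPochhammer ℂ n).eval (1 - a) / (n.factorial : ℂ)) := by
    rw [kummerCoeff]; field_simp
  rw [h4, ← hv, Finset.mul_sum]
  refine Finset.sum_congr rfl fun k hk => ?_
  have hk' : k ≤ n := Nat.lt_succ_iff.mp (Finset.mem_range.mp hk)
  have h5 : (n.choose k : ℂ) = (n.factorial : ℂ) / ((k.factorial : ℂ) * ((n - k).factorial : ℂ)) :=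
    Nat.cast_choose ℂ hk'
  have h6 : (k.factorial : ℂ) ≠ 0 := by exact_mod_cast k.factorial_ne_zero
  have h7 : ((n - k).factorial : ℂ) ≠ 0 := by exact_mod_cast (n - k).factorial_ne_zero
  have h8 : (-ζ) ^ n * (-1) ^ k = ζ ^ k * (-ζ) ^ (n - k) := by
    obtain ⟨r, rfl⟩ := Nat.exists_eq_add_of_le hk'
    rw [Nat.add_sub_cancel_left, pow_add, mul_right_comm, ← mul_pow]
    simp
  rw [h5, kummerCoeff]
  calc _ = ζ ^ k * (-ζ) ^ (n - k) * ((ascPochhammer ℂ k).eval a /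
        ((k.factorial : ℂ) ^ 2 * ((n - k).factorial : ℂ))) := by field_simp
    _ = _ := by rw [← h8]; field_simp

theorem kummer_conj (a ζ : ℂ) : conj (kummer a ζ) = kummer (conj a) (conj ζ) := by
  rw [kummer, Complex.conj_tsum, kummer]
  congr 1
  ext k
  simp [kummerCoeff, ascPochhammer_eval_conj]

theorem Gfun_eq (a ζ : ℂ) : Gfun a ζ = Complex.exp (-ζ / 2) * kummer a ζ := rfl

theorem Gfun_eq_conj {l ζ : ℂ} (hl : conj l = -l) (hζ : conj ζ = -ζ) :
    Gfun l ζ = conj (Gfun (1 + l) ζ) := by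
  rw [Gfun_eq, Gfun_eq, map_mul, kummer_conj, ← Complex.exp_conj]
  have h1 := exp_neg_mul_kummer l ζ
  have e1 : conj (1 + l) = 1 - l := by rw [map_add, hl, map_one]; ring
  have e2 : conj (-ζ / 2) = ζ / 2 := by
    rw [map_div₀, map_neg, hζ, neg_neg, Complex.conj_ofNat]
  rw [e1, e2, hζ, ← h1, ← mul_assoc, ← Complex.exp_add]
  congr 2
  ring

/-- The Euler derivative `ζ M'(a; 1; ζ)` of Kummer's function. -/
noncomputable def kummerEuler (a ζ : ℂ) : ℂ := ∑' k : ℕ, k * kummerCoeff a k * ζ ^ k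

theorem summable_norm_natCast_mul_kummerCoeff (a : ℂ) {R : ℝ} (hR : 0 ≤ R) :
    Summable fun k : ℕ => ‖(k : ℂ) * kummerCoeff a k‖ * R ^ k := by
  refine Summable.of_nonneg_of_le (fun k => by positivity) (fun k => ?_)
    (summable_norm_kummerCoeff a (2 * R))
  rw [norm_mul, Complex.norm_natCast, mul_pow]
  have : (k : ℝ) ≤ 2 ^ k := by exact_mod_cast k.lt_two_pow_self.le
  calc (k : ℝ) * ‖kummerCoeff a k‖ * R ^ k ≤ 2 ^ k * ‖kummerCoeff a k‖ * R ^ k := by gcongr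
    _ = _ := by ring

theorem hasDerivAt_tsum_pow {c : ℕ → ℂ} (hc : ∀ R : ℝ, 0 ≤ R → Summable fun k => ‖c k‖ * R ^ k)
    (z : ℂ) : ∃ d, HasDerivAt (fun ζ => ∑' k, c k * ζ ^ k) d z ∧
      HasSum (fun k : ℕ => c k * (k * z ^ (k - 1))) d := by
  have hb : ∀ (k : ℕ) (w : ℂ), w ∈ Metric.ball (0 : ℂ) (‖z‖ + 1) →
      ‖c k * w ^ k‖ ≤ ‖c k‖ * (‖z‖ + 1) ^ k := by
    intro k w hw
    rw [norm_mul, norm_pow]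
    gcongr
    exact (mem_ball_zero_iff.mp hw).le
  have hz : z ∈ Metric.ball (0 : ℂ) (‖z‖ + 1) := by simp
  have hd : ∀ k : ℕ, DifferentiableOn ℂ (fun w => c k * w ^ k) (Metric.ball (0 : ℂ) (‖z‖ + 1)) :=
    fun k => by fun_prop
  have hs := hc (‖z‖ + 1) (by positivity)
  have h1 := Complex.hasSum_deriv_of_summable_norm hs hd Metric.isOpen_ball hb hz
  have h2 := (Complex.differentiableOn_tsum_of_summable_norm hs hd Metric.isOpen_ball hb)
  refine ⟨_, (h2.differentiableAt (Metric.isOpen_ball.mem_nhds hz)).hasDerivAt, ?_⟩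
  refine h1.congr_fun fun k => ?_
  rw [deriv_const_mul_field, deriv_pow_field]

theorem exists_hasDerivAt_kummer (a z : ℂ) :
    ∃ d, HasDerivAt (kummer a) d z ∧ z * d = kummerEuler a z := by
  obtain ⟨d, h1, h2⟩ := hasDerivAt_tsum_pow (fun R _ => summable_norm_kummerCoeff a R) z
  refine ⟨d, h1, ?_⟩
  rw [kummerEuler, ← (h2.mul_left z).tsum_eq]
  congr 1
  ext k
  rcases k with _ | k
  · simp
  · rw [Nat.add_sub_cancel, pow_succ]; ring

theorem hasDerivAt_kummerEuler (a z : ℂ) :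
    HasDerivAt (kummerEuler a) (kummerEuler a z + a * kummer a z) z := by
  obtain ⟨d, h1, h2⟩ := hasDerivAt_tsum_pow
    (fun R hR => summable_norm_natCast_mul_kummerCoeff a hR) z
  have h3 : HasSum (fun k : ℕ => kummerCoeff a k * (a + k) * z ^ k) d := by
    have h4 := (hasSum_nat_add_iff' 1).mpr h2
    simp only [Finset.range_one, Finset.sum_singleton, Nat.cast_zero, zero_mul, sub_zero] at h4
    refine h4.congr_fun ?_
    intro k
    rw [← kummerCoeff_succ, Nat.add_sub_cancel]
    push_cast
    ring
  have h5 : HasSum (fun k : ℕ => kummerCoeff a k * (a + k) * z ^ k)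
      (kummerEuler a z + a * kummer a z) := by
    have h6 : Summable fun k : ℕ => (k : ℂ) * kummerCoeff a k * z ^ k := by
      refine Summable.of_norm ?_
      simpa only [norm_mul, norm_pow] using
        summable_norm_natCast_mul_kummerCoeff a (norm_nonneg z)
    refine (h6.hasSum.add ((summable_kummer a z).hasSum.mul_left a)).congr_fun ?_
    intro k
    ring
  rwa [h3.unique h5] at h1

/-- The right-hand side of the limit relation, as a function of `ζ`. -/
noncomputable def jumpWronskian (l ζ : ℂ) : ℂ :=
  deriv (Gfun (1 + l)) ζ * Gfun l ζ - Gfun (1 + l) ζ * deriv (Gfun l) ζ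

theorem hasDerivAt_Gfun {a z d : ℂ} (h : HasDerivAt (kummer a) d z) :
    HasDerivAt (Gfun a) (Complex.exp (-z / 2) * (d - kummer a z / 2)) z := by
  have h1 : HasDerivAt (fun ζ : ℂ => Complex.exp (-ζ / 2)) (Complex.exp (-z / 2) * (-1 / 2)) z :=
    (((hasDerivAt_id z).neg).div_const 2).cexp
  refine HasDerivAt.congr_deriv (h1.mul h) ?_
  change _ * kummer a z + _ = _
  ring

theorem exp_neg_eq_mul_self (z : ℂ) :
    Complex.exp (-z) = Complex.exp (-z / 2) * Complex.exp (-z / 2) := by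
  rw [← Complex.exp_add, add_halves]

theorem mul_jumpWronskian (l z : ℂ) : z * jumpWronskian l z =
    Complex.exp (-z) * (kummerEuler (1 + l) z * kummer l z - kummer (1 + l) z * kummerEuler l z) := by
  obtain ⟨d1, h1, e1⟩ := exists_hasDerivAt_kummer (1 + l) z
  obtain ⟨d0, h0, e0⟩ := exists_hasDerivAt_kummer l z
  rw [jumpWronskian, (hasDerivAt_Gfun h1).deriv, (hasDerivAt_Gfun h0).deriv, ← e1, ← e0, Gfun_eq,
    Gfun_eq, exp_neg_eq_mul_self z]
  ring

theorem hasDerivAt_mul_jumpWronskian (l z : ℂ) :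
    HasDerivAt (fun ζ => ζ * jumpWronskian l ζ) (Gfun (1 + l) z * Gfun l z) z := by
  simp only [mul_jumpWronskian]
  obtain ⟨d1, h1, e1⟩ := exists_hasDerivAt_kummer (1 + l) z
  obtain ⟨d0, h0, e0⟩ := exists_hasDerivAt_kummer l z
  have hexp : HasDerivAt (fun ζ : ℂ => Complex.exp (-ζ)) (Complex.exp (-z) * (-1)) z :=
    ((hasDerivAt_id z).neg).cexp
  have := hexp.mul (((hasDerivAt_kummerEuler (1 + l) z).mul h0).sub
    (h1.mul (hasDerivAt_kummerEuler l z)))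
  refine HasDerivAt.congr_deriv this ?_
  simp only [Pi.sub_apply, Pi.mul_apply]
  rw [Gfun_eq, Gfun_eq, exp_neg_eq_mul_self z, ← e1, ← e0]
  ring

theorem kummer_zero (a : ℂ) : kummer a 0 = 1 := by
  rw [kummer, tsum_eq_single 0]
  · simp [kummerCoeff]
  · intro k hk; simp [hk]

theorem jumpWronskian_zero (l : ℂ) : jumpWronskian l 0 = 1 := by
  have key : ∀ a : ℂ, deriv (Gfun a) 0 = a - 1 / 2 := by
    intro a
    obtain ⟨d, h1, h2⟩ := hasDerivAt_tsum_pow (fun R _ => summable_norm_kummerCoeff a R) 0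
    have h3 : d = a := by
      rw [← h2.tsum_eq, tsum_eq_single 1]
      · simp [kummerCoeff]
      · intro k hk
        rcases k with _ | _ | k
        · simp
        · exact absurd rfl hk
        · simp
    rw [h3] at h1
    have h4 : HasDerivAt (kummer a) a 0 := h1
    rw [(hasDerivAt_Gfun h4).deriv, kummer_zero]
    simp
  have hG : ∀ a : ℂ, Gfun a 0 = 1 := fun a => by rw [Gfun_eq, kummer_zero]; simp
  rw [jumpWronskian, key, key, hG, hG]
  ring

theorem continuous_Gfun (a : ℂ) : Continuous (Gfun a) := by
  have : Gfun a = fun ζ => Complex.exp (-ζ / 2) * kummer a ζ := rfl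
  rw [this]
  exact (by fun_prop : Continuous fun ζ : ℂ => Complex.exp (-ζ / 2)).mul (continuous_kummer a)

theorem integral_norm_kummer_sq_eq_jumpWronskian {l : ℂ} (hl : conj l = -l) (τ : ℝ) :
    ((∫ t in (0 : ℝ)..1, ‖kummer (1 + l) (τ * t * Complex.I)‖ ^ 2 : ℝ) : ℂ) =
      jumpWronskian l (τ * Complex.I) := by
  have h1 : ∀ t : ℝ, ((‖kummer (1 + l) (τ * t * Complex.I)‖ ^ 2 : ℝ) : ℂ) =
      Gfun (1 + l) (t * (τ * Complex.I)) * Gfun l (t * (τ * Complex.I)) := by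
    intro t
    have e : (t : ℂ) * (τ * Complex.I) = τ * t * Complex.I := by ring
    rw [e, Gfun_eq_conj hl (by simp), Complex.mul_conj, Complex.normSq_eq_norm_sq, Gfun_eq, norm_mul,
      Complex.norm_exp]
    simp
  rw [← intervalIntegral.integral_ofReal]
  simp only [h1]
  set ζ : ℂ := τ * Complex.I
  rcases eq_or_ne ζ 0 with h0 | h0
  · rw [h0, jumpWronskian_zero]
    simp [Gfun_eq, kummer_zero]
  · have hder : ∀ t : ℝ, HasDerivAt (fun t : ℝ => (t : ℂ) * ζ * jumpWronskian l (t * ζ))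
        (ζ * (Gfun (1 + l) (t * ζ) * Gfun l (t * ζ))) t := by
      intro t
      have h2 : HasDerivAt (fun t : ℝ => (t : ℂ) * ζ) ζ t := by
        simpa using (Complex.ofRealCLM.hasDerivAt (x := t)).mul_const ζ
      have := (hasDerivAt_mul_jumpWronskian l (t * ζ)).comp t h2
      rw [mul_comm ζ]
      exact this
    have hcont : Continuous fun t : ℝ => ζ * (Gfun (1 + l) (t * ζ) * Gfun l (t * ζ)) := by
      have hc : Continuous fun t : ℝ => (t : ℂ) * ζ := by fun_prop
      exact continuous_const.mul (((continuous_Gfun _).comp hc).mul ((continuous_Gfun _).comp hc))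
    have := intervalIntegral.integral_eq_sub_of_hasDerivAt (a := 0) (b := 1)
      (fun t _ => hder t) (hcont.intervalIntegrable _ _)
    rw [intervalIntegral.integral_const_mul] at this
    simp only [Complex.ofReal_one, Complex.ofReal_zero, one_mul, zero_mul, sub_zero] at this
    exact mul_left_cancel₀ h0 this

/-- The jump factor of the weight, in the variable `φ = arcsin x`. -/
noncomputable def jumpFactor (g φ : ℝ) : ℝ := if φ < 0 then Real.exp (2 * Real.pi * g) else 1

theorem jumpFactor_pos (g φ : ℝ) : 0 < jumpFactor g φ := by
  unfold jumpFactor; split_ifs <;> positivity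

theorem measurable_jumpFactor (g : ℝ) : Measurable (jumpFactor g) :=
  Measurable.ite measurableSet_Iio measurable_const measurable_const

theorem jumpFactor_le (g φ : ℝ) : jumpFactor g φ ≤ max 1 (Real.exp (2 * Real.pi * g)) := by
  unfold jumpFactor; split_ifs <;> simp

theorem le_jumpFactor (g φ : ℝ) : min 1 (Real.exp (2 * Real.pi * g)) ≤ jumpFactor g φ := by
  unfold jumpFactor; split_ifs <;> simp

theorem intervalIntegrable_mul_jumpFactor {f : ℝ → ℝ} (hf : Continuous f) (g a b : ℝ) :
    IntervalIntegrable (fun φ => f φ * jumpFactor g φ) volume a b := by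
  have h1 : AEStronglyMeasurable (jumpFactor g) volume :=
    (measurable_jumpFactor g).aestronglyMeasurable
  have h2 : ∀ φ, ‖jumpFactor g φ‖ ≤ max 1 (Real.exp (2 * Real.pi * g)) := fun φ => by
    rw [Real.norm_of_nonneg (jumpFactor_pos g φ).le]
    exact jumpFactor_le g φ
  have h3 := hf.intervalIntegrable (μ := volume) a b
  exact ⟨h3.1.mul_bdd h1.restrict (Eventually.of_forall h2),
    h3.2.mul_bdd h1.restrict (Eventually.of_forall h2)⟩

theorem integral_circle_fold {f : ℝ → ℝ} (hf : Continuous f)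
    (hp : Function.Periodic f (2 * Real.pi)) (g : ℝ) :
    ∫ θ in (0 : ℝ)..2 * Real.pi, f θ * Real.exp (g * θ) =
      (∫ φ in -(Real.pi / 2)..Real.pi / 2, f φ * Real.exp (g * φ) * jumpFactor g φ) +
      ∫ φ in -(Real.pi / 2)..Real.pi / 2, f (Real.pi - φ) * Real.exp (g * (Real.pi - φ)) := by
  set F : ℝ → ℝ := fun θ => f θ * Real.exp (g * θ) with hF
  have hFc : Continuous F := by fun_prop
  have hi : ∀ a b, IntervalIntegrable F volume a b := fun a b => hFc.intervalIntegrable a b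
  have h1 : ∫ φ in -(Real.pi / 2)..Real.pi / 2, F (Real.pi - φ) =
      ∫ θ in (Real.pi / 2)..(3 * Real.pi / 2), F θ := by
    rw [intervalIntegral.integral_comp_sub_left F Real.pi]
    congr 1 <;> ring
  have h2 : ∫ φ in -(Real.pi / 2)..0, F φ * jumpFactor g φ =
      ∫ θ in (3 * Real.pi / 2)..(2 * Real.pi), F θ := by
    have : ∫ φ in -(Real.pi / 2)..0, F φ * jumpFactor g φ =
        ∫ φ in -(Real.pi / 2)..0, F (φ + 2 * Real.pi) := by
      refine intervalIntegral.integral_congr_Ioo_of_le (by linarith [Real.pi_pos]) fun φ hφ => ?_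
      simp only [hF, jumpFactor, if_pos hφ.2, hp φ]
      rw [mul_assoc, ← Real.exp_add]
      ring_nf
    rw [this, intervalIntegral.integral_comp_add_right F]
    congr 1 <;> ring
  have h3 : ∫ φ in (0 : ℝ)..(Real.pi / 2), F φ * jumpFactor g φ =
      ∫ θ in (0 : ℝ)..(Real.pi / 2), F θ := by
    refine intervalIntegral.integral_congr_Ioo_of_le (by linarith [Real.pi_pos]) fun φ hφ => ?_
    simp [jumpFactor, not_lt.mpr hφ.1.le]
  have h4 := intervalIntegral.integral_add_adjacent_intervals
    (intervalIntegrable_mul_jumpFactor hFc g (-(Real.pi / 2)) 0)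
    (intervalIntegrable_mul_jumpFactor hFc g 0 (Real.pi / 2))
  have h5 := intervalIntegral.integral_add_adjacent_intervals
    (hi 0 (Real.pi / 2)) (hi (Real.pi / 2) (3 * Real.pi / 2))
  have h6 := intervalIntegral.integral_add_adjacent_intervals
    (hi 0 (3 * Real.pi / 2)) (hi (3 * Real.pi / 2) (2 * Real.pi))
  change ∫ θ in (0 : ℝ)..2 * Real.pi, F θ =
    (∫ φ in -(Real.pi / 2)..Real.pi / 2, F φ * jumpFactor g φ) +
      ∫ φ in -(Real.pi / 2)..Real.pi / 2, F (Real.pi - φ)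
  linarith

/-- A trigonometric polynomial concentrated at `φ = 0`. -/
noncomputable def localizer (A D : ℕ) (φ : ℝ) : ℝ := Real.cos φ ^ A * ((1 + Real.cos φ) / 2) ^ D

theorem eventually_localizer_sq_mul_le {r : ℝ → ℝ} {A : ℕ} {C : ℝ}
    (h0 : ∀ φ ∈ Ioo (-(Real.pi / 2)) (Real.pi / 2), 0 ≤ r φ) (hc : ContinuousAt r 0) (hr : r 0 = 1)
    (hC : ∀ φ ∈ Ioo (-(Real.pi / 2)) (Real.pi / 2), Real.cos φ ^ (2 * A) * r φ ≤ C)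
    {ε : ℝ} (hε : 0 < ε) :
    ∀ᶠ D in atTop, ∀ φ ∈ Ioo (-(Real.pi / 2)) (Real.pi / 2), localizer A D φ ^ 2 * r φ ≤ 1 + ε := by
  have hev : ∀ᶠ φ in nhds (0 : ℝ), r φ < 1 + ε := hc.eventually_lt_const (by rw [hr]; linarith)
  obtain ⟨η, hη, hball⟩ := Metric.eventually_nhds_iff.mp hev
  set η' := min η 1
  have hη' : 0 < η' := by positivity
  have hη1 : η' ≤ 1 := min_le_right _ _
  have hcos : Real.cos η' < 1 := by
    rw [← Real.cos_zero]
    exact Real.cos_lt_cos_of_nonneg_of_le_pi le_rfl (by linarith [Real.pi_gt_three]) hη'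
  have hcos0 : 0 ≤ Real.cos η' := Real.cos_nonneg_of_mem_Icc
    ⟨by linarith [Real.pi_gt_three], by linarith [Real.pi_gt_three]⟩
  have ht : Tendsto (fun D : ℕ => (((1 + Real.cos η') / 2) ^ 2) ^ D * C) atTop (nhds (0 * C)) :=
    (tendsto_pow_atTop_nhds_zero_of_lt_one (by positivity)
      (pow_lt_one₀ (by positivity) (by linarith) two_ne_zero)).mul_const C
  rw [zero_mul] at ht
  filter_upwards [ht.eventually_le_const zero_lt_one] with D hD φ hφ
  have hcφ : 0 < Real.cos φ := Real.cos_pos_of_mem_Ioo hφ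
  have hcφ1 : Real.cos φ ≤ 1 := Real.cos_le_one φ
  rcases lt_or_ge |φ| η' with hlt | hge
  · have h1 : r φ ≤ 1 + ε :=
      (hball (by rw [Real.dist_eq, sub_zero]; exact hlt.trans_le (min_le_left _ _))).le
    have h2 : localizer A D φ ^ 2 ≤ 1 := by
      refine pow_le_one₀ (by unfold localizer; positivity) ?_
      exact mul_le_one₀ (pow_le_one₀ hcφ.le hcφ1) (by positivity)
        (pow_le_one₀ (by positivity) (by linarith))
    calc _ ≤ 1 * r φ := by gcongr; exact h0 φ hφ
      _ ≤ _ := by linarith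
  · have h1 : Real.cos φ ≤ Real.cos η' := by
      rw [← Real.cos_abs φ]
      refine Real.cos_le_cos_of_nonneg_of_le_pi hη'.le ?_ hge
      have := abs_lt.mpr ⟨hφ.1, hφ.2⟩
      linarith [Real.pi_pos]
    have hC0 : 0 ≤ C := le_trans (mul_nonneg (by positivity) (h0 φ hφ)) (hC φ hφ)
    calc localizer A D φ ^ 2 * r φ
        = (((1 + Real.cos φ) / 2) ^ 2) ^ D * (Real.cos φ ^ (2 * A) * r φ) := by
          unfold localizer; rw [pow_right_comm, mul_pow, ← pow_mul, mul_comm A 2]; ring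
      _ ≤ (((1 + Real.cos η') / 2) ^ 2) ^ D * C := by
          have := h0 φ hφ
          gcongr
          exact hC φ hφ
      _ ≤ 1 + ε := by linarith

theorem eventually_localizer_pi_sub_sq_mul_le {r : ℝ → ℝ} {A : ℕ} {C : ℝ}
    (h0 : ∀ φ ∈ Ioo (-(Real.pi / 2)) (Real.pi / 2), 0 ≤ r φ)
    (hC : ∀ φ ∈ Ioo (-(Real.pi / 2)) (Real.pi / 2), Real.cos φ ^ (2 * A) * r φ ≤ C)
    {ε : ℝ} (hε : 0 < ε) :
    ∀ᶠ D in atTop, ∀ φ ∈ Ioo (-(Real.pi / 2)) (Real.pi / 2),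
      localizer A D (Real.pi - φ) ^ 2 * r φ ≤ ε := by
  have ht : Tendsto (fun D : ℕ => ((1 / 2 : ℝ) ^ 2) ^ D * C) atTop (nhds (0 * C)) :=
    (tendsto_pow_atTop_nhds_zero_of_lt_one (by positivity) (by norm_num)).mul_const C
  rw [zero_mul] at ht
  filter_upwards [ht.eventually_le_const hε] with D hD φ hφ
  have hcφ : 0 < Real.cos φ := Real.cos_pos_of_mem_Ioo hφ
  have hcφ1 : Real.cos φ ≤ 1 := Real.cos_le_one φ
  have h1 := h0 φ hφ
  have hC0 : 0 ≤ C := le_trans (mul_nonneg (by positivity) h1) (hC φ hφ)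
  calc localizer A D (Real.pi - φ) ^ 2 * r φ
      = (((1 - Real.cos φ) / 2) ^ 2) ^ D * (Real.cos φ ^ (2 * A) * r φ) := by
        have h2 : (-Real.cos φ) ^ (A * 2) = Real.cos φ ^ (2 * A) := by
          rw [mul_comm A 2, pow_mul, neg_sq, ← pow_mul]
        unfold localizer
        rw [Real.cos_pi_sub, mul_pow, ← pow_mul, h2, ← sub_eq_add_neg, ← pow_mul, ← pow_mul,
          mul_comm D 2]
        ring
    _ ≤ ((1 / 2 : ℝ) ^ 2) ^ D * C := by
        have : 0 ≤ (1 - Real.cos φ) / 2 := by linarith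
        gcongr
        · linarith
        · exact hC φ hφ
    _ ≤ ε := hD

theorem exists_localizerPoly (A D : ℕ) : ∃ R : Polynomial ℂ, R.natDegree ≤ 2 * A + 2 * D ∧
    ∀ φ : ℝ, ‖R.eval (Complex.exp (φ * Complex.I))‖ ^ 2 = localizer A D φ ^ 2 := by
  refine ⟨(Polynomial.C (1 / 2) * (Polynomial.X ^ 2 + 1)) ^ A *
    (Polynomial.C (1 / 4) * (Polynomial.X + 1) ^ 2) ^ D, ?_, fun φ => ?_⟩
  · refine Polynomial.natDegree_mul_le_of_le ?_ ?_
    · rw [mul_comm 2 A]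
      refine Polynomial.natDegree_pow_le_of_le A ?_
      compute_degree
    · rw [mul_comm 2 D]
      refine Polynomial.natDegree_pow_le_of_le D ?_
      compute_degree
  · set z : ℂ := Complex.exp (φ * Complex.I) with hz
    have hinv : z * Complex.exp (-φ * Complex.I) = 1 := by
      rw [hz, ← Complex.exp_add]; simp
    have hcos : 2 * ((Real.cos φ : ℝ) : ℂ) = z + Complex.exp (-φ * Complex.I) := by
      rw [Complex.ofReal_cos, Complex.two_cos]
    have h1 : 1 / 2 * (z ^ 2 + 1) = z * (Real.cos φ : ℝ) := by
      linear_combination (-1 / 2) * hinv + (-z / 2) * hcos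
    have h2 : 1 / 4 * (z + 1) ^ 2 = z * (((1 + Real.cos φ) / 2 : ℝ) : ℂ) := by
      push_cast [-Complex.ofReal_cos]
      linear_combination (-1 / 4) * hinv + (-z / 4) * hcos
    have hn : ‖z‖ = 1 := Complex.norm_exp_ofReal_mul_I φ
    simp only [Polynomial.eval_mul, Polynomial.eval_pow, Polynomial.eval_C, Polynomial.eval_add,
      Polynomial.eval_X, Polynomial.eval_one]
    rw [h1, h2, localizer]
    simp only [norm_mul, norm_pow, hn, one_mul, Complex.norm_real, Real.norm_eq_abs]
    rw [← abs_pow, ← abs_pow, ← abs_mul, sq_abs]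

theorem exists_eval_exp_eq_mul_eval_sin (P : Polynomial ℝ) {m : ℕ} (hP : P.natDegree ≤ m) :
    ∃ Q : Polynomial ℂ, Q.natDegree ≤ 2 * m ∧ ∀ φ : ℝ,
      ‖Q.eval (Complex.exp (φ * Complex.I))‖ ^ 2 = P.eval (Real.sin φ) ^ 2 := by
  refine ⟨∑ k ∈ Finset.range (m + 1), Polynomial.C (P.coeff k : ℂ) *
    ((Polynomial.C (-Complex.I / 2) * (Polynomial.X ^ 2 - 1)) ^ k * Polynomial.X ^ (m - k)), ?_,
    fun φ => ?_⟩
  · refine Polynomial.natDegree_sum_le_of_forall_le _ _ fun k hk => ?_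
    have hk' : k ≤ m := Nat.lt_succ_iff.mp (Finset.mem_range.mp hk)
    refine (Polynomial.natDegree_C_mul_le _ _).trans ?_
    refine (Polynomial.natDegree_mul_le_of_le (m := k * 2) (n := m - k)
      (Polynomial.natDegree_pow_le_of_le k ?_) (Polynomial.natDegree_X_pow_le _)).trans (by omega)
    compute_degree
  · set z : ℂ := Complex.exp (φ * Complex.I) with hz
    have hinv : z * Complex.exp (-φ * Complex.I) = 1 := by
      rw [hz, ← Complex.exp_add]; simp
    have hsin : 2 * ((Real.sin φ : ℝ) : ℂ) = (Complex.exp (-φ * Complex.I) - z) * Complex.I := by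
      rw [Complex.ofReal_sin, Complex.two_sin]
    have h1 : -Complex.I / 2 * (z ^ 2 - 1) = z * (Real.sin φ : ℝ) := by
      linear_combination (-Complex.I / 2) * hinv + (-z / 2) * hsin
    have hn : ‖z‖ = 1 := Complex.norm_exp_ofReal_mul_I φ
    have h2 : (∑ k ∈ Finset.range (m + 1), Polynomial.C (P.coeff k : ℂ) *
        ((Polynomial.C (-Complex.I / 2) * (Polynomial.X ^ 2 - 1)) ^ k *
          Polynomial.X ^ (m - k))).eval z = z ^ m * (P.eval (Real.sin φ) : ℝ) := by
      rw [Polynomial.eval_finsetSum, Polynomial.eval_eq_sum_range' (Nat.lt_succ_of_le hP),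
        Complex.ofReal_sum, Finset.mul_sum]
      refine Finset.sum_congr rfl fun k hk => ?_
      have hk' : k ≤ m := Nat.lt_succ_iff.mp (Finset.mem_range.mp hk)
      simp only [Polynomial.eval_mul, Polynomial.eval_pow, Polynomial.eval_C, Polynomial.eval_sub,
        Polynomial.eval_X, Polynomial.eval_one]
      rw [h1, mul_pow, ← Nat.sub_add_cancel hk', Nat.add_sub_cancel, pow_add]
      push_cast
      ring
    rw [h2, norm_mul, norm_pow, hn, one_pow, one_mul, Complex.norm_real, Real.norm_eq_abs, sq_abs]

theorem exp_add_exp_pi_sub (k : ℤ) (φ : ℝ) :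
    Complex.exp (φ * Complex.I) ^ k + Complex.exp ((Real.pi - φ : ℝ) * Complex.I) ^ k =
      2 * Complex.I ^ k * ((Polynomial.Chebyshev.T ℝ k).eval (Real.sin φ) : ℝ) := by
  have h1 : (Polynomial.Chebyshev.T ℝ k).eval (Real.sin φ) = Real.cos (k * (Real.pi / 2 - φ)) := by
    rw [← Real.cos_pi_div_two_sub, Polynomial.Chebyshev.T_real_cos]
  have hI : Complex.I = Complex.exp ((Real.pi / 2 : ℝ) * Complex.I) := by
    push_cast; rw [Complex.exp_pi_div_two_mul_I]
  rw [h1, Complex.ofReal_cos, mul_right_comm, Complex.two_cos, ← Complex.exp_int_mul,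
    ← Complex.exp_int_mul]
  nth_rw 5 [hI]
  rw [← Complex.exp_int_mul, add_mul, ← Complex.exp_add, ← Complex.exp_add, add_comm]
  push_cast
  congr 2 <;> ring

theorem exists_eval_exp_add_eval_exp_pi_sub (H : Polynomial ℂ) {m : ℕ} (hH : H.natDegree ≤ 2 * m) :
    ∃ P₁ P₂ : Polynomial ℝ, P₁.natDegree ≤ m ∧ P₂.natDegree ≤ m ∧ ∀ φ : ℝ,
      Complex.exp (φ * Complex.I) ^ (-m : ℤ) * H.eval (Complex.exp (φ * Complex.I)) +
      Complex.exp ((Real.pi - φ : ℝ) * Complex.I) ^ (-m : ℤ) *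
        H.eval (Complex.exp ((Real.pi - φ : ℝ) * Complex.I)) =
      (P₁.eval (Real.sin φ) : ℝ) + (P₂.eval (Real.sin φ) : ℝ) * Complex.I := by
  set b : ℕ → ℂ := fun j => H.coeff j * (2 * Complex.I ^ (j - m : ℤ)) with hb
  have hdeg : ∀ f : ℕ → ℝ, (∑ j ∈ Finset.range (2 * m + 1),
      Polynomial.C (f j) * Polynomial.Chebyshev.T ℝ (j - m : ℤ)).natDegree ≤ m := by
    intro f
    refine Polynomial.natDegree_sum_le_of_forall_le _ _ fun j hj => ?_
    have hj' : j ≤ 2 * m := Nat.lt_succ_iff.mp (Finset.mem_range.mp hj)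
    refine (Polynomial.natDegree_C_mul_le _ _).trans ?_
    rw [Polynomial.Chebyshev.natDegree_T]
    omega
  refine ⟨_, _, hdeg fun j => (b j).re, hdeg fun j => (b j).im, fun φ => ?_⟩
  have hne : ∀ t : ℝ, Complex.exp (t * Complex.I) ≠ 0 := fun t => Complex.exp_ne_zero _
  have hz : ∀ z : ℂ, z ≠ 0 → z ^ (-m : ℤ) * H.eval z =
      ∑ j ∈ Finset.range (2 * m + 1), H.coeff j * z ^ (j - m : ℤ) := by
    intro z hz
    rw [Polynomial.eval_eq_sum_range' (Nat.lt_succ_of_le hH), Finset.mul_sum]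
    refine Finset.sum_congr rfl fun j _ => ?_
    rw [sub_eq_add_neg, zpow_add₀ hz, zpow_natCast]
    ring
  rw [hz _ (hne φ), hz _ (hne _), ← Finset.sum_add_distrib, Polynomial.eval_finsetSum,
    Polynomial.eval_finsetSum, Complex.ofReal_sum, Complex.ofReal_sum, Finset.sum_mul,
    ← Finset.sum_add_distrib]
  refine Finset.sum_congr rfl fun j _ => ?_
  rw [← mul_add, exp_add_exp_pi_sub, Polynomial.eval_C_mul, Polynomial.eval_C_mul, ← mul_assoc]
  change b j * _ = _
  nth_rw 1 [← Complex.re_add_im (b j)]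
  rw [Complex.ofReal_mul, Complex.ofReal_mul]
  ring

theorem image_sin_Ioo :
    Real.sin '' Ioo (-(Real.pi / 2)) (Real.pi / 2) = Ioo (-1) 1 := by
  ext x
  constructor
  · rintro ⟨φ, hφ, rfl⟩
    exact Real.mapsTo_sin_Ioo hφ
  · intro hx
    exact ⟨Real.arcsin x, ⟨Real.neg_pi_div_two_lt_arcsin.mpr hx.1, Real.arcsin_lt_pi_div_two.mpr hx.2⟩,
      Real.sin_arcsin hx.1.le hx.2.le⟩

theorem integral_comp_sin_mul_cos (f : ℝ → ℝ) :
    ∫ φ in -(Real.pi / 2)..Real.pi / 2, f (Real.sin φ) * Real.cos φ = ∫ x in (-1 : ℝ)..1, f x := by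
  have hpi : -(Real.pi / 2) ≤ Real.pi / 2 := by linarith [Real.pi_pos]
  rw [intervalIntegral.integral_of_le hpi, intervalIntegral.integral_of_le (by norm_num),
    integral_Ioc_eq_integral_Ioo, integral_Ioc_eq_integral_Ioo, ← image_sin_Ioo,
    integral_image_eq_integral_abs_deriv_smul measurableSet_Ioo
      (fun x _ => (Real.hasDerivAt_sin x).hasDerivWithinAt)
      (Real.injOn_sin.mono Ioo_subset_Icc_self)]
  refine setIntegral_congr_fun measurableSet_Ioo fun φ hφ => ?_
  rw [abs_of_pos (Real.cos_pos_of_mem_Ioo hφ), smul_eq_mul, mul_comm]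

theorem intervalIntegrable_comp_sin_mul_cos {f : ℝ → ℝ} (hf : IntervalIntegrable f volume (-1) 1) :
    IntervalIntegrable (fun φ => f (Real.sin φ) * Real.cos φ) volume
      (-(Real.pi / 2)) (Real.pi / 2) := by
  have hpi : -(Real.pi / 2) ≤ Real.pi / 2 := by linarith [Real.pi_pos]
  rw [intervalIntegrable_iff_integrableOn_Ioo_of_le (by norm_num), ← image_sin_Ioo,
    integrableOn_image_iff_integrableOn_abs_deriv_smul measurableSet_Ioo
      (fun x _ => (Real.hasDerivAt_sin x).hasDerivWithinAt)
      (Real.injOn_sin.mono Ioo_subset_Icc_self)] at hf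
  rw [intervalIntegrable_iff_integrableOn_Ioo_of_le hpi]
  refine hf.congr_fun (fun φ hφ => ?_) measurableSet_Ioo
  simp only
  rw [abs_of_pos (Real.cos_pos_of_mem_Ioo hφ), smul_eq_mul, mul_comm]

/-- The Christoffel–Darboux kernel on the diagonal. -/
noncomputable def lineKernel (p : ℕ → Polynomial ℝ) (n : ℕ) (x : ℝ) : ℝ :=
  ∑ k ∈ Finset.range n, (p k).eval x * (p k).eval x

theorem lineKernel_nonneg (p : ℕ → Polynomial ℝ) (n : ℕ) (x : ℝ) : 0 ≤ lineKernel p n x :=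
  Finset.sum_nonneg fun _ _ => mul_self_nonneg _

section Line

variable {w : ℝ → ℝ} {p : ℕ → Polynomial ℝ}

theorem intervalIntegrable_weight (hp_deg : ∀ n, (p n).natDegree = n)
    (hp_orth : ∀ m n : ℕ,
      ∫ x in (-1 : ℝ)..1, (p m).eval x * (p n).eval x * w x = if m = n then 1 else 0) :
    IntervalIntegrable w volume (-1) 1 := by
  obtain ⟨a, ha⟩ : ∃ a, p 0 = Polynomial.C a := ⟨_, Polynomial.eq_C_of_natDegree_eq_zero (hp_deg 0)⟩
  have h1 := hp_orth 0 0
  simp only [ha, Polynomial.eval_C, if_true] at h1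
  have ha0 : a * a ≠ 0 := by
    intro h0
    simp [h0] at h1
  by_contra hcon
  have h2 : ¬ IntervalIntegrable (fun x => a * a * w x) volume (-1) 1 := fun h3 =>
    hcon (by simpa only [inv_mul_cancel_left₀ ha0] using h3.const_mul (a * a)⁻¹)
  rw [intervalIntegral.integral_undef h2] at h1
  exact zero_ne_one h1

theorem intervalIntegrable_eval_mul_weight (hw : IntervalIntegrable w volume (-1) 1)
    (P : Polynomial ℝ) : IntervalIntegrable (fun x => P.eval x * w x) volume (-1) 1 :=
  hw.continuousOn_mul P.continuous.continuousOn

theorem intervalIntegrable_eval_sq_mul_weight (hw : IntervalIntegrable w volume (-1) 1)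
    (P : Polynomial ℝ) : IntervalIntegrable (fun x => P.eval x ^ 2 * w x) volume (-1) 1 :=
  hw.continuousOn_mul (P.continuous.pow 2).continuousOn

theorem integral_sum_sq_mul_weight (hw : IntervalIntegrable w volume (-1) 1)
    (hp_orth : ∀ m n : ℕ,
      ∫ x in (-1 : ℝ)..1, (p m).eval x * (p n).eval x * w x = if m = n then 1 else 0)
    (n : ℕ) (a : ℕ → ℝ) :
    ∫ x in (-1 : ℝ)..1, (∑ k ∈ Finset.range n, Polynomial.C (a k) * p k).eval x ^ 2 * w x =
      ∑ k ∈ Finset.range n, a k ^ 2 := by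
  have h1 : ∀ x, (∑ k ∈ Finset.range n, Polynomial.C (a k) * p k).eval x ^ 2 * w x =
      ∑ j ∈ Finset.range n, ∑ k ∈ Finset.range n,
        a j * a k * ((p j).eval x * (p k).eval x * w x) := by
    intro x
    simp only [Polynomial.eval_finsetSum, Polynomial.eval_C_mul]
    rw [sq, Finset.sum_mul_sum, Finset.sum_mul]
    refine Finset.sum_congr rfl fun j _ => ?_
    rw [Finset.sum_mul]
    exact Finset.sum_congr rfl fun k _ => by ring
  have h2 : ∀ j k, IntervalIntegrable
      (fun x => a j * a k * ((p j).eval x * (p k).eval x * w x)) volume (-1) 1 := fun j k => by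
    simpa only [Polynomial.eval_mul] using
      (intervalIntegrable_eval_mul_weight hw (p j * p k)).const_mul (a j * a k)
  have h3 : ∀ j, IntervalIntegrable (fun x => ∑ k ∈ Finset.range n,
      a j * a k * ((p j).eval x * (p k).eval x * w x)) volume (-1) 1 := fun j => by
    have := IntervalIntegrable.sum (Finset.range n) fun k _ => h2 j k
    rwa [Finset.sum_fn] at this
  simp only [h1]
  rw [intervalIntegral.integral_finsetSum fun j _ => h3 j]
  refine Finset.sum_congr rfl fun j hj => ?_
  rw [intervalIntegral.integral_finsetSum fun k _ => h2 j k]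
  simp only [intervalIntegral.integral_const_mul, hp_orth]
  simp only [mul_ite, mul_one, mul_zero, Finset.sum_ite_eq, hj, if_true, sq]

theorem exists_eval_eq_lineKernel (hw : IntervalIntegrable w volume (-1) 1)
    (hp_deg : ∀ n, (p n).natDegree = n)
    (hp_orth : ∀ m n : ℕ,
      ∫ x in (-1 : ℝ)..1, (p m).eval x * (p n).eval x * w x = if m = n then 1 else 0)
    (n : ℕ) (x : ℝ) :
    ∃ P : Polynomial ℝ, P.natDegree ≤ n - 1 ∧ P.eval x = lineKernel p n x ∧
      ∫ y in (-1 : ℝ)..1, P.eval y ^ 2 * w y = lineKernel p n x := by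
  refine ⟨∑ k ∈ Finset.range n, Polynomial.C ((p k).eval x) * p k, ?_, ?_, ?_⟩
  · refine Polynomial.natDegree_sum_le_of_forall_le _ _ fun k hk => ?_
    refine (Polynomial.natDegree_C_mul_le _ _).trans ?_
    rw [hp_deg]
    have := Finset.mem_range.mp hk
    omega
  · simp only [Polynomial.eval_finsetSum, Polynomial.eval_C_mul, lineKernel]
  · rw [integral_sum_sq_mul_weight hw hp_orth]
    simp only [sq, lineKernel]

theorem eval_sq_le_lineKernel_mul (hw : IntervalIntegrable w volume (-1) 1)
    (hp_deg : ∀ n, (p n).natDegree = n) (hp0 : ∀ n, p n ≠ 0)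
    (hp_orth : ∀ m n : ℕ,
      ∫ x in (-1 : ℝ)..1, (p m).eval x * (p n).eval x * w x = if m = n then 1 else 0)
    {n : ℕ} {P : Polynomial ℝ} (hP : P.natDegree < n) (x : ℝ) :
    P.eval x ^ 2 ≤ lineKernel p n x * ∫ y in (-1 : ℝ)..1, P.eval y ^ 2 * w y := by
  obtain ⟨a, rfl⟩ := exists_eq_sum_C_mul_of_natDegree_eq hp_deg hp0 n P
    (Polynomial.degree_le_natDegree.trans_lt (by exact_mod_cast hP))
  rw [integral_sum_sq_mul_weight hw hp_orth, mul_comm]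
  simp only [Polynomial.eval_finsetSum, Polynomial.eval_C_mul, lineKernel, ← sq]
  exact Finset.sum_mul_sq_le_sq_mul_sq _ _ _

end Line

/-- The squared modulus of a polynomial on the unit circle. -/
noncomputable def circleSq (Q : Polynomial ℂ) (φ : ℝ) : ℝ :=
  ‖Q.eval (Complex.exp (φ * Complex.I))‖ ^ 2

theorem circleSq_nonneg (Q : Polynomial ℂ) (φ : ℝ) : 0 ≤ circleSq Q φ := sq_nonneg _

theorem circleSq_mul (Q R : Polynomial ℂ) (φ : ℝ) :
    circleSq (Q * R) φ = circleSq Q φ * circleSq R φ := by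
  rw [circleSq, Polynomial.eval_mul, norm_mul, mul_pow]; rfl

theorem continuous_circleSq (Q : Polynomial ℂ) : Continuous (circleSq Q) := by
  have h : Continuous fun φ : ℝ => Q.eval (Complex.exp (φ * Complex.I)) :=
    Q.continuous.comp (by fun_prop)
  exact h.norm.pow 2

theorem periodic_circleSq (Q : Polynomial ℂ) : Function.Periodic (circleSq Q) (2 * Real.pi) := by
  intro φ
  have : Complex.exp ((φ + 2 * Real.pi : ℝ) * Complex.I) = Complex.exp (φ * Complex.I) := by
    push_cast
    rw [add_mul, Complex.exp_add, Complex.exp_two_pi_mul_I, mul_one]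
  simp only [circleSq, this]

theorem circleEnergy_fold (g : ℝ) (Q : Polynomial ℂ) : circleEnergy g Q =
    (∫ φ in -(Real.pi / 2)..Real.pi / 2, circleSq Q φ * Real.exp (g * φ) * jumpFactor g φ) +
      ∫ φ in -(Real.pi / 2)..Real.pi / 2, circleSq Q (Real.pi - φ) * Real.exp (g * (Real.pi - φ)) :=
  integral_circle_fold (continuous_circleSq Q) (periodic_circleSq Q) g

theorem intervalIntegrable_circleSq_mul_jumpFactor (g : ℝ) (Q : Polynomial ℂ) (a b : ℝ) :
    IntervalIntegrable (fun φ => circleSq Q φ * Real.exp (g * φ) * jumpFactor g φ) volume a b :=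
  intervalIntegrable_mul_jumpFactor ((continuous_circleSq Q).mul (by fun_prop)) g a b

theorem intervalIntegrable_circleSq_pi_sub (g : ℝ) (Q : Polynomial ℂ) (a b : ℝ) :
    IntervalIntegrable (fun φ => circleSq Q (Real.pi - φ) * Real.exp (g * (Real.pi - φ)))
      volume a b := by
  have := continuous_circleSq Q
  exact Continuous.intervalIntegrable (by fun_prop) a b

section Comparison

variable {w : ℝ → ℝ} {p : ℕ → Polynomial ℝ} {g κ ε : ℝ} {G : ℝ → ℝ} {A D : ℕ}

theorem lineKernel_mul_localizer_sq_le (hg : g ≠ 0) (hε : 0 < ε) (hκ : 0 < κ)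
    (hp_deg : ∀ n, (p n).natDegree = n)
    (hp_orth : ∀ m n : ℕ,
      ∫ x in (-1 : ℝ)..1, (p m).eval x * (p n).eval x * w x = if m = n then 1 else 0)
    (hG : ∀ φ ∈ Ioo (-(Real.pi / 2)) (Real.pi / 2),
      w (Real.sin φ) * Real.cos φ = G φ * jumpFactor g φ)
    (h1 : ∀ φ ∈ Ioo (-(Real.pi / 2)) (Real.pi / 2),
      κ * (localizer A D φ ^ 2 * Real.exp (g * φ)) ≤ (1 + ε) * G φ)
    (h2 : ∀ φ ∈ Ioo (-(Real.pi / 2)) (Real.pi / 2),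
      κ * (localizer A D (Real.pi - φ) ^ 2 * Real.exp (g * (Real.pi - φ))) ≤
        ε * (G φ * jumpFactor g φ))
    {n N : ℕ} (hN : 2 * n + 2 * A + 2 * D = N + 1) (hn : n ≠ 0) (φ : ℝ) :
    κ * (lineKernel p n (Real.sin φ) * localizer A D φ ^ 2) ≤
      (1 + 2 * ε) * circleKernel g N φ := by
  have hpi : -(Real.pi / 2) ≤ Real.pi / 2 := by linarith [Real.pi_pos]
  have hw := intervalIntegrable_weight hp_deg hp_orth
  obtain ⟨P, hP, hPx, hPi⟩ := exists_eval_eq_lineKernel hw hp_deg hp_orth n (Real.sin φ)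
  obtain ⟨Q, hQ, hQs⟩ := exists_eval_exp_eq_mul_eval_sin P hP
  obtain ⟨R, hR, hRs⟩ := exists_localizerPoly A D
  set k := lineKernel p n (Real.sin φ) with hk
  have hT : ∀ θ, circleSq (Q * R) θ = P.eval (Real.sin θ) ^ 2 * localizer A D θ ^ 2 := fun θ => by
    rw [circleSq_mul, circleSq, circleSq, hQs, hRs]
  have hdeg : (Q * R).degree < N := by
    refine Polynomial.degree_le_natDegree.trans_lt ?_
    have := Polynomial.natDegree_mul_le_of_le hQ hR
    exact_mod_cast (by omega : (Q * R).natDegree < N)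
  have hmain := norm_eval_sq_le_circleKernel_mul hg N (Q * R) hdeg φ
  change circleSq (Q * R) φ ≤ _ at hmain
  rw [hT, hPx] at hmain
  have hPw : IntervalIntegrable (fun x => P.eval x ^ 2 * w x) volume (-1) 1 :=
    intervalIntegrable_eval_sq_mul_weight hw P
  have hW := intervalIntegrable_comp_sin_mul_cos hPw
  have hen : κ * circleEnergy g (Q * R) ≤ (1 + 2 * ε) * k := by
    rw [circleEnergy_fold, ← intervalIntegral.integral_add
      (intervalIntegrable_circleSq_mul_jumpFactor _ _ _ _)
      (intervalIntegrable_circleSq_pi_sub _ _ _ _), ← intervalIntegral.integral_const_mul, ← hPi,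
      ← integral_comp_sin_mul_cos, ← intervalIntegral.integral_const_mul]
    refine intervalIntegral.integral_mono_on_of_le_Ioo hpi ?_ (hW.const_mul _) fun θ hθ => ?_
    · exact ((intervalIntegrable_circleSq_mul_jumpFactor _ _ _ _).add
        (intervalIntegrable_circleSq_pi_sub _ _ _ _)).const_mul _
    · have hJ := jumpFactor_pos g θ
      have hP0 := sq_nonneg (P.eval (Real.sin θ))
      have e1 := mul_le_mul_of_nonneg_left (h1 θ hθ) (mul_nonneg hP0 hJ.le)
      have e2 := mul_le_mul_of_nonneg_left (h2 θ hθ) hP0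
      rw [hT, hT, Real.sin_pi_sub, mul_assoc (P.eval (Real.sin θ) ^ 2) (w _), hG θ hθ]
      linear_combination e1 + e2
  have hk0 : 0 ≤ k := lineKernel_nonneg _ _ _
  have hc0 : 0 ≤ circleKernel g N φ := by
    have := jumpNorm_pos hg
    unfold circleKernel; positivity
  rcases hk0.eq_or_lt with h0 | h0
  · rw [← h0]
    simp only [zero_mul, mul_zero]
    positivity
  · refine le_of_mul_le_mul_left ?_ h0
    calc k * (κ * (k * localizer A D φ ^ 2)) = κ * (k ^ 2 * localizer A D φ ^ 2) := by ring
      _ ≤ κ * (circleKernel g N φ * circleEnergy g (Q * R)) := by gcongr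
      _ = circleKernel g N φ * (κ * circleEnergy g (Q * R)) := by ring
      _ ≤ circleKernel g N φ * ((1 + 2 * ε) * k) := by gcongr
      _ = _ := by ring

theorem circleKernel_mul_localizer_sq_le (hg : g ≠ 0) (hε : 0 < ε) (hκ : 0 < κ)
    (hp_deg : ∀ n, (p n).natDegree = n) (hp0 : ∀ n, p n ≠ 0)
    (hp_orth : ∀ m n : ℕ,
      ∫ x in (-1 : ℝ)..1, (p m).eval x * (p n).eval x * w x = if m = n then 1 else 0)
    (hG : ∀ φ ∈ Ioo (-(Real.pi / 2)) (Real.pi / 2),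
      w (Real.sin φ) * Real.cos φ = G φ * jumpFactor g φ)
    (hG0 : ∀ φ ∈ Ioo (-(Real.pi / 2)) (Real.pi / 2), 0 ≤ G φ)
    (h1 : ∀ φ ∈ Ioo (-(Real.pi / 2)) (Real.pi / 2),
      localizer A D φ ^ 2 * G φ ≤ (1 + ε) * (κ * Real.exp (g * φ)))
    (h2 : ∀ φ ∈ Ioo (-(Real.pi / 2)) (Real.pi / 2),
      localizer A D (Real.pi - φ) ^ 2 * (G φ * jumpFactor g φ) ≤
        ε ^ 2 * (κ * Real.exp (g * (Real.pi - φ))))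
    {n N : ℕ} (hN : 2 * n = N + 2 * A + 2 * D + 2) (hN0 : N ≠ 0) (φ : ℝ) :
    circleKernel g N φ * (localizer A D φ ^ 2 * Real.cos φ ^ 2) ≤
      (1 + ε) ^ 2 * (κ * lineKernel p n (Real.sin φ)) := by
  have hpi : -(Real.pi / 2) ≤ Real.pi / 2 := by linarith [Real.pi_pos]
  have hw := intervalIntegrable_weight hp_deg hp_orth
  obtain ⟨Q, hQ, hE, hQe⟩ := exists_norm_eval_sq_eq_circleKernel_mul hg hN0 φ
  change circleSq Q φ = _ at hQe
  obtain ⟨R, hR, hRs⟩ := exists_localizerPoly A D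
  set F : Polynomial ℂ := Polynomial.C (1 / 2) *
    (Polynomial.X + Polynomial.C (Complex.exp ((-φ : ℝ) * Complex.I))) with hF
  have hFle : ∀ θ, circleSq F θ ≤ 1 := by
    intro θ
    have : ‖F.eval (Complex.exp (θ * Complex.I))‖ ≤ 1 := by
      simp only [hF, Polynomial.eval_mul, Polynomial.eval_C, Polynomial.eval_add, Polynomial.eval_X]
      rw [norm_mul]
      have h3 := norm_add_le (Complex.exp (θ * Complex.I)) (Complex.exp ((-φ : ℝ) * Complex.I))
      rw [Complex.norm_exp_ofReal_mul_I, Complex.norm_exp_ofReal_mul_I] at h3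
      rw [show ‖(1 / 2 : ℂ)‖ = 1 / 2 by norm_num]
      linarith
    exact pow_le_one₀ (norm_nonneg _) this
  have hFφ : circleSq F φ = Real.cos φ ^ 2 := by
    have : F.eval (Complex.exp (φ * Complex.I)) = (Real.cos φ : ℝ) := by
      simp only [hF, Polynomial.eval_mul, Polynomial.eval_C, Polynomial.eval_add, Polynomial.eval_X]
      rw [Complex.ofReal_cos, Complex.cos]
      push_cast
      ring
    rw [circleSq, this, Complex.norm_real, Real.norm_eq_abs, sq_abs]
  have hFpi : (Q * R * F).eval (Complex.exp ((Real.pi - φ : ℝ) * Complex.I)) = 0 := by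
    rw [Polynomial.eval_mul, mul_eq_zero]
    right
    simp only [hF, Polynomial.eval_mul, Polynomial.eval_C, Polynomial.eval_add, Polynomial.eval_X]
    push_cast
    rw [sub_mul, sub_eq_add_neg, Complex.exp_add, Complex.exp_pi_mul_I]
    ring_nf
  have hdeg : (Q * R * F).natDegree ≤ 2 * (n - 1) := by
    have hFd : F.natDegree ≤ 1 := by rw [hF]; compute_degree
    have := Polynomial.natDegree_mul_le_of_le
      (Polynomial.natDegree_mul_le_of_le (Nat.le_sub_one_of_lt hQ) hR) hFd
    omega
  obtain ⟨P₁, P₂, hP₁, hP₂, hV⟩ := exists_eval_exp_add_eval_exp_pi_sub (Q * R * F) hdeg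
  have hle : ∀ θ, circleSq (Q * R * F) θ ≤ circleSq Q θ * localizer A D θ ^ 2 := by
    intro θ
    rw [circleSq_mul, circleSq_mul, show circleSq R θ = localizer A D θ ^ 2 from hRs θ]
    exact mul_le_of_le_one_right (mul_nonneg (circleSq_nonneg _ _) (sq_nonneg _)) (hFle θ)
  have hnz : ∀ (θ : ℝ) (k : ℤ), ‖Complex.exp (θ * Complex.I) ^ k‖ = 1 := fun θ k => by
    rw [norm_zpow, Complex.norm_exp_ofReal_mul_I, one_zpow]
  have hVn : ∀ θ : ℝ, P₁.eval (Real.sin θ) ^ 2 + P₂.eval (Real.sin θ) ^ 2 =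
      ‖Complex.exp (θ * Complex.I) ^ (-(n - 1 : ℕ) : ℤ) *
        (Q * R * F).eval (Complex.exp (θ * Complex.I)) +
      Complex.exp ((Real.pi - θ : ℝ) * Complex.I) ^ (-(n - 1 : ℕ) : ℤ) *
        (Q * R * F).eval (Complex.exp ((Real.pi - θ : ℝ) * Complex.I))‖ ^ 2 := by
    intro θ
    rw [hV θ, ← Complex.normSq_eq_norm_sq, Complex.normSq_add_mul_I]
  have hφ : P₁.eval (Real.sin φ) ^ 2 + P₂.eval (Real.sin φ) ^ 2 =
      circleKernel g N φ * circleEnergy g Q * (localizer A D φ ^ 2 * Real.cos φ ^ 2) := by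
    rw [hVn φ, hFpi, mul_zero, add_zero, norm_mul, hnz,
      one_mul]
    change circleSq (Q * R * F) φ = _
    rw [circleSq_mul, circleSq_mul, hFφ, show circleSq R φ = localizer A D φ ^ 2 from hRs φ, hQe]
    ring
  have hVle : ∀ θ : ℝ, P₁.eval (Real.sin θ) ^ 2 + P₂.eval (Real.sin θ) ^ 2 ≤
      (1 + ε) * (circleSq Q θ * localizer A D θ ^ 2) +
      (1 + 1 / ε) * (circleSq Q (Real.pi - θ) * localizer A D (Real.pi - θ) ^ 2) := by
    intro θ
    rw [hVn θ]
    have e0 := norm_add_le (Complex.exp (θ * Complex.I) ^ (-(n - 1 : ℕ) : ℤ) *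
        (Q * R * F).eval (Complex.exp (θ * Complex.I)))
      (Complex.exp ((Real.pi - θ : ℝ) * Complex.I) ^ (-(n - 1 : ℕ) : ℤ) *
        (Q * R * F).eval (Complex.exp ((Real.pi - θ : ℝ) * Complex.I)))
    rw [norm_mul, norm_mul, hnz, hnz, one_mul, one_mul] at e0
    have e1 := hle θ
    have e2 := hle (Real.pi - θ)
    rw [circleSq] at e1 e2
    set a := ‖(Q * R * F).eval (Complex.exp (θ * Complex.I))‖
    set b := ‖(Q * R * F).eval (Complex.exp ((Real.pi - θ : ℝ) * Complex.I))‖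
    have e3 : (a + b) ^ 2 ≤ (1 + ε) * a ^ 2 + (1 + 1 / ε) * b ^ 2 := by
      have : (1 + ε) * a ^ 2 + (1 + 1 / ε) * b ^ 2 - (a + b) ^ 2 = (ε * a - b) ^ 2 / ε := by
        field_simp; ring
      have : 0 ≤ (ε * a - b) ^ 2 / ε := by positivity
      linarith
    calc _ ≤ (a + b) ^ 2 := by gcongr
      _ ≤ _ := e3
      _ ≤ _ := by gcongr
  have hPw : ∀ P : Polynomial ℝ, IntervalIntegrable (fun x => P.eval x ^ 2 * w x) volume (-1) 1 :=
    intervalIntegrable_eval_sq_mul_weight hw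
  have hsum : (∫ x in (-1 : ℝ)..1, P₁.eval x ^ 2 * w x) + ∫ x in (-1 : ℝ)..1, P₂.eval x ^ 2 * w x ≤
      (1 + ε) ^ 2 * κ * circleEnergy g Q := by
    have hI1 := intervalIntegrable_circleSq_mul_jumpFactor g Q (-(Real.pi / 2)) (Real.pi / 2)
    have hI2 := intervalIntegrable_circleSq_pi_sub g Q (-(Real.pi / 2)) (Real.pi / 2)
    rw [← integral_comp_sin_mul_cos, ← integral_comp_sin_mul_cos,
      ← intervalIntegral.integral_add (intervalIntegrable_comp_sin_mul_cos (hPw _))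
        (intervalIntegrable_comp_sin_mul_cos (hPw _)), circleEnergy_fold,
      ← intervalIntegral.integral_add hI1 hI2, ← intervalIntegral.integral_const_mul]
    refine intervalIntegral.integral_mono_on_of_le_Ioo hpi
      ((intervalIntegrable_comp_sin_mul_cos (hPw _)).add
        (intervalIntegrable_comp_sin_mul_cos (hPw _))) ((hI1.add hI2).const_mul _) fun θ hθ => ?_
    have hJ := jumpFactor_pos g θ
    have hq1 := circleSq_nonneg Q θ
    have hq2 := circleSq_nonneg Q (Real.pi - θ)
    have hGJ : 0 ≤ G θ * jumpFactor g θ := mul_nonneg (hG0 θ hθ) hJ.le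
    have e1 := mul_le_mul_of_nonneg_left (h1 θ hθ)
      (mul_nonneg (mul_nonneg (by linarith : 0 ≤ 1 + ε) hq1) hJ.le)
    have e2 := mul_le_mul_of_nonneg_left (h2 θ hθ)
      (mul_nonneg (by positivity : 0 ≤ 1 + 1 / ε) hq2)
    have e3 := mul_le_mul_of_nonneg_right (hVle θ) hGJ
    have e4 : (1 + 1 / ε) * ε ^ 2 = ε + ε ^ 2 := by field_simp; ring
    have e5 : 0 ≤ (1 + ε) * (κ * (circleSq Q (Real.pi - θ) * Real.exp (g * (Real.pi - θ)))) := by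
      positivity
    calc _ = (P₁.eval (Real.sin θ) ^ 2 + P₂.eval (Real.sin θ) ^ 2) * (G θ * jumpFactor g θ) := by
          rw [← hG θ hθ]; ring
      _ ≤ _ := e3
      _ ≤ (1 + ε) ^ 2 * κ * (circleSq Q θ * Real.exp (g * θ) * jumpFactor g θ) +
          ((1 + 1 / ε) * ε ^ 2) *
            (κ * (circleSq Q (Real.pi - θ) * Real.exp (g * (Real.pi - θ)))) := by
          linear_combination e1 + e2
      _ ≤ _ := by rw [e4]; linear_combination e5
  have hk0 := lineKernel_nonneg p n (Real.sin φ)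
  have hc1 := eval_sq_le_lineKernel_mul hw hp_deg hp0 hp_orth (n := n) (P := P₁) (by omega)
    (Real.sin φ)
  have hc2 := eval_sq_le_lineKernel_mul hw hp_deg hp0 hp_orth (n := n) (P := P₂) (by omega)
    (Real.sin φ)
  refine le_of_mul_le_mul_right ?_ hE
  calc _ = P₁.eval (Real.sin φ) ^ 2 + P₂.eval (Real.sin φ) ^ 2 := by rw [hφ]; ring
    _ ≤ lineKernel p n (Real.sin φ) * ((∫ x in (-1 : ℝ)..1, P₁.eval x ^ 2 * w x) +
        ∫ x in (-1 : ℝ)..1, P₂.eval x ^ 2 * w x) := by linarith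
    _ ≤ lineKernel p n (Real.sin φ) * ((1 + ε) ^ 2 * κ * circleEnergy g Q) := by gcongr
    _ = _ := by ring

end Comparison

theorem exists_localizer_bounds {g κ C : ℝ} {G : ℝ → ℝ} {A : ℕ} (hκ : 0 < κ)
    (hG0 : ∀ φ ∈ Ioo (-(Real.pi / 2)) (Real.pi / 2), 0 < G φ) (hGc : ContinuousAt G 0)
    (hGκ : G 0 = κ)
    (hC1 : ∀ φ ∈ Ioo (-(Real.pi / 2)) (Real.pi / 2), Real.cos φ ^ (2 * A) ≤ C * G φ)
    (hC2 : ∀ φ ∈ Ioo (-(Real.pi / 2)) (Real.pi / 2), Real.cos φ ^ (2 * A) * G φ ≤ C)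
    {ε : ℝ} (hε : 0 < ε) :
    ∃ D : ℕ, ∀ φ ∈ Ioo (-(Real.pi / 2)) (Real.pi / 2),
      κ * (localizer A D φ ^ 2 * Real.exp (g * φ)) ≤ (1 + ε) * G φ ∧
      κ * (localizer A D (Real.pi - φ) ^ 2 * Real.exp (g * (Real.pi - φ))) ≤
        ε * (G φ * jumpFactor g φ) ∧
      localizer A D φ ^ 2 * G φ ≤ (1 + ε) * (κ * Real.exp (g * φ)) ∧
      localizer A D (Real.pi - φ) ^ 2 * (G φ * jumpFactor g φ) ≤
        ε ^ 2 * (κ * Real.exp (g * (Real.pi - φ))) := by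
  set E : ℝ := Real.exp (|g| * (2 * Real.pi)) with hE
  have hEpos : 0 < E := Real.exp_pos _
  have hexp : ∀ t : ℝ, |t| ≤ 2 * Real.pi → Real.exp (g * t) ≤ E := by
    intro t ht
    refine Real.exp_le_exp.mpr ((le_abs_self _).trans ?_)
    rw [abs_mul]
    gcongr
  have hexp' : ∀ t : ℝ, |t| ≤ 2 * Real.pi → (Real.exp (g * t))⁻¹ ≤ E := by
    intro t ht
    rw [← Real.exp_neg, ← mul_neg]
    exact hexp _ (by rwa [abs_neg])
  have hb1 : ∀ φ ∈ Ioo (-(Real.pi / 2)) (Real.pi / 2), |φ| ≤ 2 * Real.pi := fun φ hφ =>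
    abs_le.mpr ⟨by linarith [hφ.1, Real.pi_pos], by linarith [hφ.2, Real.pi_pos]⟩
  have hb2 : ∀ φ ∈ Ioo (-(Real.pi / 2)) (Real.pi / 2), |Real.pi - φ| ≤ 2 * Real.pi := fun φ hφ =>
    abs_le.mpr ⟨by linarith [hφ.2, Real.pi_pos], by linarith [hφ.1, Real.pi_pos]⟩
  have hC0 : 0 ≤ C := by
    have h0 : (0 : ℝ) ∈ Ioo (-(Real.pi / 2)) (Real.pi / 2) :=
      ⟨by linarith [Real.pi_pos], by linarith [Real.pi_pos]⟩
    exact le_trans (mul_nonneg (by simp) (hG0 0 h0).le) (hC2 0 h0)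
  set J₀ : ℝ := min 1 (Real.exp (2 * Real.pi * g))
  have hJ₀ : 0 < J₀ := lt_min one_pos (Real.exp_pos _)
  set J₁ : ℝ := max 1 (Real.exp (2 * Real.pi * g))
  have hcos : ∀ φ ∈ Ioo (-(Real.pi / 2)) (Real.pi / 2), 0 < Real.cos φ := fun φ hφ =>
    Real.cos_pos_of_mem_Ioo hφ
  have hCG : ∀ φ ∈ Ioo (-(Real.pi / 2)) (Real.pi / 2), Real.cos φ ^ (2 * A) * (G φ)⁻¹ ≤ C :=
    fun φ hφ => by
      rw [← div_eq_mul_inv, div_le_iff₀ (hG0 φ hφ)]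
      exact hC1 φ hφ
  have hG0' : G 0 ≠ 0 := by rw [hGκ]; exact hκ.ne'
  have u1 := eventually_localizer_sq_mul_le (A := A) (C := C * (κ * E))
    (r := fun φ => (G φ)⁻¹ * (κ * Real.exp (g * φ)))
    (fun φ hφ => by have := hG0 φ hφ; positivity)
    ((hGc.inv₀ hG0').mul (by fun_prop)) (by simp [hGκ, hκ.ne'])
    (fun φ hφ => by
      have := hG0 φ hφ
      have := hcos φ hφ
      rw [← mul_assoc]
      gcongr
      · exact hCG φ hφ
      · exact hexp φ (hb1 φ hφ)) hε
  have u2 := eventually_localizer_pi_sub_sq_mul_le (A := A) (C := C * (J₀⁻¹ * (κ * E)))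
    (r := fun φ => (G φ)⁻¹ * ((jumpFactor g φ)⁻¹ * (κ * Real.exp (g * (Real.pi - φ)))))
    (fun φ hφ => by have := hG0 φ hφ; have := jumpFactor_pos g φ; positivity)
    (fun φ hφ => by
      have := hG0 φ hφ
      have := hcos φ hφ
      have := jumpFactor_pos g φ
      rw [← mul_assoc]
      gcongr
      · exact hCG φ hφ
      · exact le_jumpFactor g φ
      · exact hexp _ (hb2 φ hφ)) hε
  have l1 := eventually_localizer_sq_mul_le (A := A) (C := C * (κ⁻¹ * E))
    (r := fun φ => G φ * (κ⁻¹ * (Real.exp (g * φ))⁻¹))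
    (fun φ hφ => by have := hG0 φ hφ; positivity)
    (hGc.mul (continuousAt_const.mul
      (ContinuousAt.inv₀ (by fun_prop) (Real.exp_pos _).ne'))) (by simp [hGκ, hκ.ne'])
    (fun φ hφ => by
      have := hG0 φ hφ
      have := hcos φ hφ
      rw [← mul_assoc]
      gcongr
      · exact hC2 φ hφ
      · exact hexp' φ (hb1 φ hφ)) hε
  have l2 := eventually_localizer_pi_sub_sq_mul_le (A := A) (C := C * (J₁ * (κ⁻¹ * E)))
    (r := fun φ => G φ * (jumpFactor g φ * (κ⁻¹ * (Real.exp (g * (Real.pi - φ)))⁻¹)))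
    (fun φ hφ => by have := hG0 φ hφ; have := jumpFactor_pos g φ; positivity)
    (fun φ hφ => by
      have := hG0 φ hφ
      have := hcos φ hφ
      have := jumpFactor_pos g φ
      rw [← mul_assoc]
      gcongr
      · exact hC2 φ hφ
      · exact jumpFactor_le g φ
      · exact hexp' _ (hb2 φ hφ)) (pow_pos hε 2)
  obtain ⟨D, h1, h2, h3, h4⟩ := (u1.and (u2.and (l1.and l2))).exists
  refine ⟨D, fun φ hφ => ?_⟩
  have hG := hG0 φ hφ
  have hJ := jumpFactor_pos g φ
  have he := Real.exp_pos (g * φ)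
  have he' := Real.exp_pos (g * (Real.pi - φ))
  refine ⟨?_, ?_, ?_, ?_⟩
  · have := mul_le_mul_of_nonneg_right (h1 φ hφ) hG.le
    refine le_of_eq_of_le ?_ this
    field_simp
  · have := mul_le_mul_of_nonneg_right (h2 φ hφ) (mul_pos hG hJ).le
    refine le_of_eq_of_le ?_ this
    field_simp
  · have := mul_le_mul_of_nonneg_right (h3 φ hφ) (mul_pos hκ he).le
    refine le_of_eq_of_le ?_ this
    field_simp
  · have := mul_le_mul_of_nonneg_right (h4 φ hφ) (mul_pos hκ he').le
    refine le_of_eq_of_le ?_ this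
    field_simp

section Limit

variable {ι : Type*} {l : Filter ι} {n : ι → ℕ} {φ : ι → ℝ} {τ : ℝ}

theorem tendsto_zero_of_tendsto_natCast_mul (hn : Tendsto n l atTop)
    (hφ : Tendsto (fun i => n i * φ i) l (nhds τ)) : Tendsto φ l (nhds 0) := by
  have h1 : Tendsto (fun i => (n i : ℝ)) l atTop := tendsto_natCast_atTop_atTop.comp hn
  refine (hφ.div_atTop h1).congr' ?_
  filter_upwards [hn.eventually_ne_atTop 0] with i hi
  have : (n i : ℝ) ≠ 0 := by exact_mod_cast hi
  field_simp

/-- The limit of `circleKernel g N φ / N` as `N φ → τ`. -/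
noncomputable def circleLimit (g τ : ℝ) : ℝ :=
  (∫ t in (0 : ℝ)..1, ‖kummer (1 - Complex.I * g) (τ * t * Complex.I)‖ ^ 2) / jumpNorm g

theorem tendsto_circleKernel_div_natCast [l.IsCountablyGenerated] (g k : ℝ) {N : ι → ℕ}
    (hn : Tendsto n l atTop) (hφ : Tendsto (fun i => n i * φ i) l (nhds τ))
    (hN : ∀ᶠ i in l, (N i : ℝ) = 2 * n i + k) :
    Tendsto (fun i => circleKernel g (N i) (φ i) / n i) l (nhds (2 * circleLimit g (2 * τ))) := by
  have h1 : Tendsto (fun i => (n i : ℝ)) l atTop := tendsto_natCast_atTop_atTop.comp hn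
  have hφ0 := tendsto_zero_of_tendsto_natCast_mul hn hφ
  have hN' : Tendsto N l atTop := by
    rw [← tendsto_natCast_atTop_iff (R := ℝ)]
    exact (tendsto_atTop_add_const_right _ k (h1.const_mul_atTop two_pos)).congr'
      (hN.mono fun i hi => hi.symm)
  have hNφ : Tendsto (fun i => N i * φ i) l (nhds (2 * τ)) := by
    have := (hφ.const_mul 2).add (hφ0.const_mul k)
    rw [mul_zero, add_zero] at this
    refine this.congr' (hN.mono fun i hi => ?_)
    simp only [hi]; ring
  have hr : Tendsto (fun i => (N i : ℝ) / n i) l (nhds 2) := by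
    have := (tendsto_const_nhds (x := (2 : ℝ))).add (tendsto_const_nhds (x := k) |>.div_atTop h1)
    rw [add_zero] at this
    refine this.congr' ?_
    filter_upwards [hN, hn.eventually_ne_atTop 0] with i hi hi0
    have : (n i : ℝ) ≠ 0 := by exact_mod_cast hi0
    rw [hi]; field_simp
  refine (hr.mul (tendsto_circleKernel_div g hN' hNφ)).congr' ?_
  filter_upwards [hN'.eventually_ne_atTop 0] with i hi
  have : (N i : ℝ) ≠ 0 := by exact_mod_cast hi
  field_simp

theorem tendsto_localizer (A D : ℕ) (hφ : Tendsto φ l (nhds 0)) :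
    Tendsto (fun i => localizer A D (φ i)) l (nhds 1) := by
  have h : Continuous (localizer A D) := by unfold localizer; fun_prop
  have h0 : localizer A D 0 = 1 := by simp [localizer]
  have := (h.tendsto 0).comp hφ
  rw [h0] at this
  exact this

theorem tendsto_lineKernel_div [l.IsCountablyGenerated] {w : ℝ → ℝ} {p : ℕ → Polynomial ℝ}
    {g κ C : ℝ} {G : ℝ → ℝ} {A : ℕ} (hg : g ≠ 0) (hκ : 0 < κ)
    (hp_deg : ∀ n, (p n).natDegree = n) (hp0 : ∀ n, p n ≠ 0)
    (hp_orth : ∀ m n : ℕ,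
      ∫ x in (-1 : ℝ)..1, (p m).eval x * (p n).eval x * w x = if m = n then 1 else 0)
    (hG : ∀ φ ∈ Ioo (-(Real.pi / 2)) (Real.pi / 2),
      w (Real.sin φ) * Real.cos φ = G φ * jumpFactor g φ)
    (hG0 : ∀ φ ∈ Ioo (-(Real.pi / 2)) (Real.pi / 2), 0 < G φ) (hGc : ContinuousAt G 0)
    (hGκ : G 0 = κ)
    (hC1 : ∀ φ ∈ Ioo (-(Real.pi / 2)) (Real.pi / 2), Real.cos φ ^ (2 * A) ≤ C * G φ)
    (hC2 : ∀ φ ∈ Ioo (-(Real.pi / 2)) (Real.pi / 2), Real.cos φ ^ (2 * A) * G φ ≤ C)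
    (hn : Tendsto n l atTop) (hφ : Tendsto (fun i => n i * φ i) l (nhds τ)) :
    Tendsto (fun i => lineKernel p (n i) (Real.sin (φ i)) / n i) l
      (nhds (2 * circleLimit g (2 * τ) / κ)) := by
  have hφ0 := tendsto_zero_of_tendsto_natCast_mul hn hφ
  have hcos : Tendsto (fun i => Real.cos (φ i)) l (nhds 1) := by
    have := (Real.continuous_cos.tendsto 0).comp hφ0
    rw [Real.cos_zero] at this
    exact this
  set L := 2 * circleLimit g (2 * τ) with hL
  refine tendsto_order.mpr ⟨fun a ha => ?_, fun b hb => ?_⟩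
  · have hev : ∀ᶠ ε in nhdsWithin (0 : ℝ) (Ioi 0), a < L / ((1 + ε) ^ 2 * κ) := by
      have hc : ContinuousAt (fun ε : ℝ => L / ((1 + ε) ^ 2 * κ)) 0 :=
        ContinuousAt.div (by fun_prop) (by fun_prop) (by simpa using hκ.ne')
      exact (hc.eventually_const_lt (by simpa using ha)).filter_mono nhdsWithin_le_nhds
    obtain ⟨ε, hε, hεpos⟩ := (hev.and self_mem_nhdsWithin).exists
    replace hεpos : 0 < ε := hεpos
    obtain ⟨D, hD⟩ := exists_localizer_bounds (g := g) hκ hG0 hGc hGκ hC1 hC2 hεpos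
    have hlarge : ∀ᶠ i in l, 2 * A + 2 * D + 3 ≤ 2 * n i := by
      filter_upwards [hn.eventually_ge_atTop (2 * A + 2 * D + 3)] with i hi
      omega
    set N : ι → ℕ := fun i => 2 * n i - (2 * A + 2 * D + 2) with hNdef
    have hlim := tendsto_circleKernel_div_natCast (N := N) g (-(2 * A + 2 * D + 2)) hn hφ (by
      filter_upwards [hlarge] with i hi
      rw [hNdef]
      simp only
      rw [Nat.cast_sub (by omega)]
      push_cast; ring)
    have hlow : Tendsto (fun i => circleKernel g (N i) (φ i) / n i *
        (localizer A D (φ i) ^ 2 * Real.cos (φ i) ^ 2) / ((1 + ε) ^ 2 * κ)) l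
        (nhds (L / ((1 + ε) ^ 2 * κ))) := by
      have := (hlim.mul (((tendsto_localizer A D hφ0).pow 2).mul (hcos.pow 2))).div_const
        ((1 + ε) ^ 2 * κ)
      simpa only [one_pow, mul_one] using this
    filter_upwards [hlow.eventually_const_lt hε, hlarge] with i hi hi2
    refine hi.trans_le ?_
    have := circleKernel_mul_localizer_sq_le hg hεpos hκ hp_deg hp0 hp_orth hG
      (fun φ hφ => (hG0 φ hφ).le) (fun φ hφ => (hD φ hφ).2.2.1) (fun φ hφ => (hD φ hφ).2.2.2)
      (n := n i) (N := N i) (by simp only [hNdef]; omega) (by simp only [hNdef]; omega) (φ i)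
    rw [div_le_iff₀ (by positivity), div_mul_eq_mul_div, div_mul_eq_mul_div]
    refine div_le_div_of_nonneg_right ?_ (Nat.cast_nonneg _)
    linear_combination this
  · have hev : ∀ᶠ ε in nhdsWithin (0 : ℝ) (Ioi 0), (1 + 2 * ε) * L / κ < b := by
      have hc : ContinuousAt (fun ε : ℝ => (1 + 2 * ε) * L / κ) 0 := by fun_prop
      exact (hc.eventually_lt_const (by simpa using hb)).filter_mono nhdsWithin_le_nhds
    obtain ⟨ε, hε, hεpos⟩ := (hev.and self_mem_nhdsWithin).exists
    replace hεpos : 0 < ε := hεpos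
    obtain ⟨D, hD⟩ := exists_localizer_bounds (g := g) hκ hG0 hGc hGκ hC1 hC2 hεpos
    set N : ι → ℕ := fun i => 2 * n i + 2 * A + 2 * D - 1 with hNdef
    have hlim := tendsto_circleKernel_div_natCast (N := N) g (2 * A + 2 * D - 1) hn hφ (by
      filter_upwards [hn.eventually_ne_atTop 0] with i hi
      rw [hNdef]
      simp only
      rw [Nat.cast_sub (by omega)]
      push_cast; ring)
    have hS := (tendsto_localizer A D hφ0).pow 2
    rw [one_pow] at hS
    have hup : Tendsto (fun i => (1 + 2 * ε) * (circleKernel g (N i) (φ i) / n i) / κ /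
        localizer A D (φ i) ^ 2) l (nhds ((1 + 2 * ε) * L / κ)) := by
      have := ((hlim.const_mul (1 + 2 * ε)).div_const κ).div hS one_ne_zero
      rwa [div_one] at this
    filter_upwards [hup.eventually_lt_const hε, hn.eventually_ne_atTop 0,
      hS.eventually_const_lt (u := 0) one_pos] with i hi hi2 hi3
    refine lt_of_le_of_lt ?_ hi
    have := lineKernel_mul_localizer_sq_le hg hεpos hκ hp_deg hp_orth hG
      (fun φ hφ => (hD φ hφ).1) (fun φ hφ => (hD φ hφ).2.1)
      (n := n i) (N := N i) (by simp only [hNdef]; omega) hi2 (φ i)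
    rw [le_div_iff₀ hi3, le_div_iff₀ hκ, ← mul_div_assoc, div_mul_eq_mul_div, div_mul_eq_mul_div]
    refine div_le_div_of_nonneg_right ?_ (Nat.cast_nonneg _)
    linear_combination this

end Limit

theorem pow_le_rpow_and_pow_mul_rpow_le_one {x α : ℝ} {m : ℕ} (hx : 0 < x) (hx1 : x ≤ 1)
    (hα : |α| ≤ m) : x ^ m ≤ x ^ α ∧ x ^ m * x ^ α ≤ 1 := by
  rw [← Real.rpow_natCast, ← Real.rpow_add hx]
  refine ⟨Real.rpow_le_rpow_of_exponent_ge hx hx1 ((le_abs_self α).trans hα),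
    Real.rpow_le_one hx.le hx1 ?_⟩
  linarith [neg_abs_le α]

/-- The Jacobi type weight `h(x) (1 - x)^α (1 + x)^β`, multiplied by `q` and pulled back by `sin`. -/
noncomputable def sinWeight (q α β : ℝ) (h : ℝ → ℝ) (φ : ℝ) : ℝ :=
  q * h (Real.sin φ) * (1 - Real.sin φ) ^ α * (1 + Real.sin φ) ^ β * Real.cos φ

section Weight

variable {q α β : ℝ} {h : ℝ → ℝ}

theorem sinWeight_pos (hq : 0 < q) (h_pos : ∀ x ∈ Icc (-1 : ℝ) 1, 0 < h x) {φ : ℝ}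
    (hφ : φ ∈ Ioo (-(Real.pi / 2)) (Real.pi / 2)) : 0 < sinWeight q α β h φ := by
  have hc := Real.cos_pos_of_mem_Ioo hφ
  have h2 := Real.sin_sq_add_cos_sq φ
  have hs1 : 0 < 1 - Real.sin φ := by nlinarith
  have hs2 : 0 < 1 + Real.sin φ := by nlinarith
  have := h_pos _ (Real.sin_mem_Icc φ)
  unfold sinWeight
  positivity

theorem sinWeight_zero : sinWeight q α β h 0 = q * h 0 := by simp [sinWeight]

theorem continuousAt_sinWeight_zero (hh : ContinuousAt h 0) :
    ContinuousAt (sinWeight q α β h) 0 := by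
  have h1 : ContinuousAt (fun φ => h (Real.sin φ)) 0 :=
    ContinuousAt.comp (g := h) (by rwa [Real.sin_zero]) Real.continuous_sin.continuousAt
  have h2 : ContinuousAt (fun φ => (1 - Real.sin φ) ^ α) 0 :=
    ContinuousAt.rpow_const (by fun_prop) (by simp)
  have h3 : ContinuousAt (fun φ => (1 + Real.sin φ) ^ β) 0 :=
    ContinuousAt.rpow_const (by fun_prop) (by simp)
  exact (((continuousAt_const.mul h1).mul h2).mul h3).mul Real.continuous_cos.continuousAt

theorem exists_cos_pow_le_sinWeight (hq : 0 < q) (hh : ContinuousOn h (Icc (-1) 1))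
    (h_pos : ∀ x ∈ Icc (-1 : ℝ) 1, 0 < h x) :
    ∃ (A : ℕ) (C : ℝ), ∀ φ ∈ Ioo (-(Real.pi / 2)) (Real.pi / 2),
      Real.cos φ ^ (2 * A) ≤ C * sinWeight q α β h φ ∧
      Real.cos φ ^ (2 * A) * sinWeight q α β h φ ≤ C := by
  obtain ⟨m, hm⟩ := exists_nat_ge (max |α| |β|)
  have hne : (Icc (-1 : ℝ) 1).Nonempty := nonempty_Icc.mpr (by norm_num)
  obtain ⟨x₀, hx₀, hmin⟩ := isCompact_Icc.exists_isMinOn hne hh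
  obtain ⟨x₁, hx₁, hmax⟩ := isCompact_Icc.exists_isMaxOn hne hh
  have hx₀' := h_pos _ hx₀
  set k : ℝ := 2 ^ α * 2 ^ β with hk
  have hk0 : 0 < k := by positivity
  refine ⟨m + 1, max (4 ^ m / (q * h x₀ * k)) (4 ^ m * (q * h x₁ * k)), fun φ hφ => ?_⟩
  have hc := Real.cos_pos_of_mem_Ioo hφ
  have hc1 := Real.cos_le_one φ
  have h2 := Real.sin_sq_add_cos_sq φ
  have hs := Real.sin_mem_Icc φ
  have hg0 := sinWeight_pos (α := α) (β := β) hq h_pos hφ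
  have hmin' : h x₀ ≤ h (Real.sin φ) := hmin hs
  have hmax' : h (Real.sin φ) ≤ h x₁ := hmax hs
  have hpos := h_pos _ hs
  obtain ⟨a, ha⟩ : ∃ a, a = (1 - Real.sin φ) / 2 := ⟨_, rfl⟩
  obtain ⟨b, hb⟩ : ∃ b, b = (1 + Real.sin φ) / 2 := ⟨_, rfl⟩
  have ha0 : 0 < a := by nlinarith
  have hb0 : 0 < b := by nlinarith
  obtain ⟨a1, a2⟩ := pow_le_rpow_and_pow_mul_rpow_le_one (α := α) (m := m) ha0
    (by linarith [hs.1]) ((le_max_left _ _).trans hm)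
  obtain ⟨b1, b2⟩ := pow_le_rpow_and_pow_mul_rpow_le_one (α := β) (m := m) hb0
    (by linarith [hs.2]) ((le_max_right _ _).trans hm)
  have hcos : Real.cos φ ^ (2 * (m + 1)) = Real.cos φ * Real.cos φ * (4 ^ m * (a ^ m * b ^ m)) := by
    have : Real.cos φ ^ 2 = 4 * (a * b) := by rw [ha, hb]; linarith
    rw [pow_mul, pow_succ, this, mul_pow, mul_pow, ← this]; ring
  have hw : sinWeight q α β h φ =
      q * h (Real.sin φ) * k * (a ^ α * b ^ β) * Real.cos φ := by
    have e1 : 1 - Real.sin φ = 2 * a := by rw [ha]; ring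
    have e2 : 1 + Real.sin φ = 2 * b := by rw [hb]; ring
    rw [sinWeight, e1, e2, Real.mul_rpow two_pos.le ha0.le, Real.mul_rpow two_pos.le hb0.le, hk]
    ring
  have ha' := Real.rpow_pos_of_pos ha0 α
  have hb' := Real.rpow_pos_of_pos hb0 β
  constructor
  · refine le_trans ?_ (mul_le_mul_of_nonneg_right (le_max_left _ _) hg0.le)
    rw [hcos, hw]
    calc Real.cos φ * Real.cos φ * (4 ^ m * (a ^ m * b ^ m))
        ≤ 1 * Real.cos φ * (4 ^ m * (a ^ α * b ^ β)) := by gcongr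
      _ = 4 ^ m / (q * h x₀ * k) * (q * h x₀ * k * (a ^ α * b ^ β) * Real.cos φ) := by
        field_simp
      _ ≤ _ := by gcongr
  · refine le_trans ?_ (le_max_right _ _)
    rw [hcos, hw]
    calc Real.cos φ * Real.cos φ * (4 ^ m * (a ^ m * b ^ m)) *
          (q * h (Real.sin φ) * k * (a ^ α * b ^ β) * Real.cos φ)
        = Real.cos φ * Real.cos φ * Real.cos φ *
          (4 ^ m * (q * h (Real.sin φ) * k)) * ((a ^ m * a ^ α) * (b ^ m * b ^ β)) := by ring
      _ ≤ 1 * 1 * 1 * (4 ^ m * (q * h x₁ * k)) * (1 * 1) := by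
        have := hpos.le.trans hmax'
        gcongr
      _ = _ := by ring

theorem tendsto_lineKernel_div_of_weight {c : ℝ} (hc : 0 < c) (hc1 : c ≠ 1)
    (h_an : AnalyticOnNhd ℝ h (Icc (-1) 1)) (h_pos : ∀ x ∈ Icc (-1 : ℝ) 1, 0 < h x)
    {w : ℝ → ℝ}
    (hw : ∀ x : ℝ, w x = h x * (1 - x) ^ α * (1 + x) ^ β * (if x < 0 then 1 else c ^ 2))
    {p : ℕ → Polynomial ℝ} (hp_deg : ∀ n, (p n).natDegree = n)
    (hp_lead : ∀ n, 0 < (p n).leadingCoeff)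
    (hp_orth : ∀ m n : ℕ,
      ∫ x in (-1 : ℝ)..1, (p m).eval x * (p n).eval x * w x = if m = n then 1 else 0)
    {ι : Type*} {l : Filter ι} [l.IsCountablyGenerated] {n : ι → ℕ} {y : ι → ℝ} {τ : ℝ}
    (hn : Tendsto n l atTop) (hy : Tendsto (fun i => n i * y i) l (nhds τ)) :
    Tendsto (fun i => lineKernel p (n i) (y i) / n i) l
      (nhds (2 * circleLimit (-Real.log c / Real.pi) (2 * τ) / (c ^ 2 * h 0))) := by
  have h00 := h_pos 0 (by norm_num)
  have hlog : Real.log c ≠ 0 := Real.log_ne_zero_of_pos_of_ne_one hc hc1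
  have hhc : ContinuousAt h 0 := (h_an 0 (by norm_num)).continuousAt
  have hJ : Real.exp (2 * Real.pi * (-Real.log c / Real.pi)) * c ^ 2 = 1 := by
    have : 2 * Real.pi * (-Real.log c / Real.pi) = -(Real.log c + Real.log c) := by
      field_simp; ring
    rw [this, Real.exp_neg, Real.exp_add, Real.exp_log hc]
    field_simp
  obtain ⟨A, C, hC⟩ := exists_cos_pow_le_sinWeight (q := c ^ 2) (α := α) (β := β)
    (by positivity) h_an.continuousOn h_pos
  have hy0 := tendsto_zero_of_tendsto_natCast_mul hn hy
  have hφ : Tendsto (fun i => n i * Real.arcsin (y i)) l (nhds τ) := by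
    have hd : HasDerivAt Real.arcsin 1 0 := by
      simpa using Real.hasDerivAt_arcsin (x := 0) (by norm_num) (by norm_num)
    have h1 : Tendsto (dslope Real.arcsin 0) (nhds 0) (nhds 1) := by
      have := (continuousAt_dslope_same.mpr hd.differentiableAt).tendsto
      rwa [dslope_same, hd.deriv] at this
    have h2 := hy.mul (h1.comp hy0)
    rw [mul_one] at h2
    refine h2.congr fun i => ?_
    have := sub_smul_dslope Real.arcsin 0 (y i)
    rw [sub_zero, smul_eq_mul, Real.arcsin_zero, sub_zero] at this
    rw [Function.comp_apply, mul_assoc, this]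
  have := tendsto_lineKernel_div (g := -Real.log c / Real.pi) (G := sinWeight (c ^ 2) α β h)
    (κ := c ^ 2 * h 0) (C := C) (A := A) (w := w) (div_ne_zero (neg_ne_zero.mpr hlog) Real.pi_ne_zero)
    (by positivity) hp_deg
    (fun n h0 => by simpa [h0] using hp_lead n) hp_orth (fun φ hφ => ?_)
    (fun φ hφ => sinWeight_pos (by positivity) h_pos hφ) (continuousAt_sinWeight_zero hhc)
    sinWeight_zero (fun φ hφ => (hC φ hφ).1) (fun φ hφ => (hC φ hφ).2) hn hφ
  · refine this.congr' ?_
    filter_upwards [hy0.eventually (Icc_mem_nhds (a := -1) (b := 1) (by norm_num) (by norm_num))]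
      with i hi
    rw [Real.sin_arcsin hi.1 hi.2]
  · rw [hw, sinWeight, jumpFactor]
    rcases lt_or_ge φ 0 with h0 | h0
    · rw [if_pos h0, if_pos (Real.sin_neg_of_neg_of_neg_pi_lt h0 (by linarith [hφ.1, Real.pi_pos]))]
      linear_combination -(h (Real.sin φ) * (1 - Real.sin φ) ^ α * (1 + Real.sin φ) ^ β *
        Real.cos φ) * hJ
    · rw [if_neg h0.not_gt,
        if_neg (Real.sin_nonneg_of_nonneg_of_le_pi h0 (by linarith [hφ.2, Real.pi_pos])).not_gt]
      ring

end Weight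

theorem tendstoUniformlyOn_of_forall_tendsto_prod {f : ℝ → ℂ} {F : ℕ → ℝ → ℂ} (hf : Continuous f)
    (hF : ∀ x, Tendsto (fun z : ℕ × ℝ => F z.1 z.2) (atTop ×ˢ nhds x) (nhds (f x)))
    {K : Set ℝ} (hK : IsCompact K) : TendstoUniformlyOn F f atTop K := by
  refine (tendstoLocallyUniformlyOn_iff_tendstoUniformlyOn_of_compact hK).mp
    (tendstoLocallyUniformlyOn_iff_forall_tendsto.mpr fun x _ => ?_)
  have h1 : Tendsto (fun z : ℕ × ℝ => f z.2) (atTop ×ˢ nhds x) (nhds (f x)) :=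
    (hf.tendsto x).comp tendsto_snd
  exact ((h1.prodMk_nhds (hF x)).mono_right (nhds_le_uniformity (f x))).mono_left
    (Filter.prod_mono le_rfl nhdsWithin_le_nhds)

theorem circleLimit_zero (g : ℝ) : circleLimit g 0 = 1 / jumpNorm g := by
  simp [circleLimit, kummer_zero]

theorem stmt10
    (α β c : ℝ) (hα : -1 < α) (hβ : -1 < β) (hc : 0 < c) (hc1 : c ≠ 1)
    (h : ℝ → ℝ)
    (h_an : AnalyticOnNhd ℝ h (Icc (-1) 1))
    (h_pos : ∀ x ∈ Icc (-1 : ℝ) 1, 0 < h x)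
    -- the weight w_c(x) = h(x)(1-x)^α(1+x)^β Ξ_c(x)
    (w : ℝ → ℝ)
    (hw : ∀ x : ℝ, w x = h x * (1 - x) ^ α * (1 + x) ^ β * (if x < 0 then 1 else c ^ 2))
    -- the orthonormal polynomials with respect to w_c
    (p : ℕ → Polynomial ℝ)
    (hp_deg : ∀ n, (p n).natDegree = n)
    (hp_lead : ∀ n, 0 < (p n).leadingCoeff)
    (hp_orth : ∀ m n : ℕ,
      ∫ x in (-1 : ℝ)..1, (p m).eval x * (p n).eval x * w x = if m = n then 1 else 0)
    (δ : ℝ) (hδ : δ ∈ Ioo (0 : ℝ) 1) :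
    -- locally uniformly on (-δ,δ), Kₙ(πx/n,πx/n)/Kₙ(0,0) → G'(1+λ)G(λ) − G(1+λ)G'(λ) at 2πix
    ∀ K : Set ℝ, IsCompact K → K ⊆ Ioo (-δ) δ →
      TendstoUniformlyOn
        (fun (n : ℕ) (x : ℝ) =>
          (((∑ k ∈ Finset.range n,
                (p k).eval (Real.pi * x / n) * (p k).eval (Real.pi * x / n)) /
              (∑ k ∈ Finset.range n, (p k).eval 0 * (p k).eval 0) : ℝ) : ℂ))
        (fun x =>
          deriv (Gfun (1 + lamC c)) (2 * (Real.pi : ℂ) * Complex.I * (x : ℂ)) *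
              Gfun (lamC c) (2 * (Real.pi : ℂ) * Complex.I * (x : ℂ)) -
            Gfun (1 + lamC c) (2 * (Real.pi : ℂ) * Complex.I * (x : ℂ)) *
              deriv (Gfun (lamC c)) (2 * (Real.pi : ℂ) * Complex.I * (x : ℂ)))
        atTop K := by
  intro K hK _
  set g : ℝ := -Real.log c / Real.pi with hg
  have hlam : lamC c = -(Complex.I * g) := by
    rw [lamC, hg]; push_cast; ring
  have hconj : conj (lamC c) = -lamC c := by
    rw [hlam]; simp
  have hlog : Real.log c ≠ 0 := Real.log_ne_zero_of_pos_of_ne_one hc hc1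
  have hJ : 0 < jumpNorm g := jumpNorm_pos (div_ne_zero (neg_ne_zero.mpr hlog) Real.pi_ne_zero)
  have hκ : 0 < c ^ 2 * h 0 := mul_pos (by positivity) (h_pos 0 (by norm_num))
  set f : ℝ → ℝ := fun x => ∫ t in (0 : ℝ)..1,
    ‖kummer (1 + lamC c) ((2 * (Real.pi * x) : ℝ) * t * Complex.I)‖ ^ 2 with hf
  have hfc : Continuous f := by
    have hk := continuous_kummer (1 + lamC c)
    exact intervalIntegral.continuous_parametric_intervalIntegral_of_continuous' (by fun_prop) 0 1
  have hlimit : ∀ x, circleLimit g (2 * (Real.pi * x)) = f x / jumpNorm g := fun x => by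
    rw [hf, circleLimit, hlam, sub_eq_add_neg]
  have hfeq : ∀ x : ℝ, (f x : ℂ) = jumpWronskian (lamC c) (2 * Real.pi * Complex.I * x) := by
    intro x
    rw [hf, integral_norm_kummer_sq_eq_jumpWronskian hconj]
    push_cast
    congr 1
    ring
  have key : TendstoUniformlyOn (fun (n : ℕ) (x : ℝ) =>
      ((lineKernel p n (Real.pi * x / n) / lineKernel p n 0 : ℝ) : ℂ)) (fun x => (f x : ℂ))
      atTop K := by
    refine tendstoUniformlyOn_of_forall_tendsto_prod (Complex.continuous_ofReal.comp hfc)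
      (fun x => (Complex.continuous_ofReal.tendsto _).comp ?_) hK
    have hn : Tendsto (fun z : ℕ × ℝ => z.1) (atTop ×ˢ nhds x) atTop := tendsto_fst
    have hy : Tendsto (fun z : ℕ × ℝ => (z.1 : ℝ) * (Real.pi * z.2 / z.1)) (atTop ×ˢ nhds x)
        (nhds (Real.pi * x)) := by
      refine (tendsto_snd.const_mul Real.pi).congr' ?_
      filter_upwards [hn.eventually_ne_atTop 0] with z hz
      have : (z.1 : ℝ) ≠ 0 := by exact_mod_cast hz
      field_simp
    have h1 := tendsto_lineKernel_div_of_weight hc hc1 h_an h_pos hw hp_deg hp_lead hp_orth hn hy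
    have h2 := tendsto_lineKernel_div_of_weight hc hc1 h_an h_pos hw hp_deg hp_lead hp_orth hn
      (y := fun _ => 0) (τ := 0) (by simp)
    rw [← hg, mul_zero, circleLimit_zero] at h2
    rw [← hg, hlimit] at h1
    have h3 := h1.div h2 (by positivity)
    have e : 2 * (f x / jumpNorm g) / (c ^ 2 * h 0) / (2 * (1 / jumpNorm g) / (c ^ 2 * h 0)) =
        f x := by
      have := hJ.ne'
      have := (h_pos 0 (by norm_num)).ne'
      field_simp
    rw [e] at h3
    refine h3.congr' ?_
    filter_upwards [hn.eventually_ne_atTop 0] with z hz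
    have : (z.1 : ℝ) ≠ 0 := by exact_mod_cast hz
    exact div_div_div_cancel_right₀ this _ _
  refine key.congr_right fun x _ => ?_
  exact hfeq x
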